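/- arXiv:2309.14039 — 3 statements merged into one kernel-verified Lean document; each statement's English description precedes it below -/
import Mathlib

section
/- Let r ≥ 1 and let T_1,…,T_r be trees with pairwise disjoint finite nonempty vertex sets A_1,…,A_r, and set n := |A_1| + … + |A_r|. Then the number N of trees on the vertex set A_1 ∪ … ∪ A_r that contain all edges of T_1,…,T_r satisfies N · n = n^{r−1} · |A_1| · … · |A_r| (equivalently, N = n^{r−2} · ∏_{i=1}^r |A_i|). -/
open Finset BigOperators
open scoped Classical

namespace GenCayley

/-- The number of trees containing a given graph. -/
noncomputable def numTrees {V : Type*} [Fintype V] (F : SimpleGraph V) : ℕ :=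
  (Finset.univ.filter (fun S : SimpleGraph V => S.IsTree ∧ F ≤ S)).card

/-- Merge the label of `v` into the label of `u`. -/
noncomputable def merge {V : Type*} {ι : Type} (f : V → ι) (u v : V) (h : f u ≠ f v) (w : V) :
    {k : ι // k ≠ f v} :=
  if hw : f w = f v then ⟨f u, h⟩ else ⟨f w, hw⟩

lemma merge_eq_iff {V : Type*} {ι : Type} (f : V → ι) (u v : V) (h : f u ≠ f v) (x y : V) :
    merge f u v h x = merge f u v h y ↔
      (f x = f y ∨ (f x = f v ∧ f y = f u) ∨ (f x = f u ∧ f y = f v)) := by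
  unfold merge
  split_ifs <;> simp only [Subtype.mk.injEq] <;> grind

lemma reachable_of_adj_eq {V α : Type*} (G : SimpleGraph V) (f : V → α)
    (hG : ∀ x y, G.Adj x y → f x = f y) (x y : V) (h : G.Reachable x y) : f x = f y := by
  obtain ⟨p⟩ := h
  induction p with
  | nil => rfl
  | cons hadj p ih => exact (hG _ _ hadj).trans ih

lemma merge_reachable {V : Type*} {ι : Type} (F : SimpleGraph V) (f : V → ι)
    (hf : ∀ x y, F.Reachable x y ↔ f x = f y) (u v : V) (h : f u ≠ f v) (x y : V) :
    (F ⊔ SimpleGraph.edge u v).Reachable x y ↔ merge f u v h x = merge f u v h y := by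
  constructor
  · apply reachable_of_adj_eq
    intro x y hxy
    rw [merge_eq_iff]
    rw [SimpleGraph.sup_adj, SimpleGraph.edge_adj] at hxy
    rcases hxy with hxy | ⟨hxy, -⟩
    · exact Or.inl ((hf x y).1 hxy.reachable)
    · grind
  · rw [merge_eq_iff]
    have hle : F ≤ F ⊔ SimpleGraph.edge u v := le_sup_left
    have huv : (F ⊔ SimpleGraph.edge u v).Reachable u v := by
      apply SimpleGraph.Adj.reachable
      rw [SimpleGraph.sup_adj, SimpleGraph.edge_adj]
      grind
    rintro (h1 | ⟨h1, h2⟩ | ⟨h1, h2⟩)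
    · exact ((hf _ _).2 h1).mono hle
    · exact (((hf _ _).2 h1).mono hle).trans (huv.symm.trans (((hf _ _).2 h2.symm).mono hle))
    · exact (((hf _ _).2 h1).mono hle).trans (huv.trans (((hf _ _).2 h2.symm).mono hle))

lemma merge_surj {V : Type*} {ι : Type} (f : V → ι) (hs : Function.Surjective f)
    (u v : V) (h : f u ≠ f v) : Function.Surjective (merge f u v h) := by
  rintro ⟨k, hk⟩
  obtain ⟨w, rfl⟩ := hs k
  exact ⟨w, by simp [merge, hk]⟩

/-- Fiber size. -/
noncomputable def fib {V : Type*} [Fintype V] {ι : Type} (f : V → ι) (k : ι) : ℕ :=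
  (univ.filter (fun w => f w = k)).card

lemma fib_pos {V : Type*} [Fintype V] {ι : Type} (f : V → ι) (hs : Function.Surjective f)
    (k : ι) : 0 < fib f k := by
  obtain ⟨w, rfl⟩ := hs k
  exact Finset.card_pos.2 ⟨w, by simp⟩

lemma merge_fib_u {V : Type*} [Fintype V] {ι : Type} (f : V → ι) (u v : V) (h : f u ≠ f v) :
    fib (merge f u v h) ⟨f u, h⟩ = fib f (f u) + fib f (f v) := by
  unfold fib
  rw [← Finset.card_union_of_disjoint]
  · congr 1
    ext w
    simp only [mem_filter, mem_univ, true_and, mem_union]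
    unfold merge
    split_ifs <;> simp_all
  · rw [Finset.disjoint_left]
    intro w; simp only [mem_filter, mem_univ, true_and]; grind

lemma merge_fib_ne {V : Type*} [Fintype V] {ι : Type} (f : V → ι) (u v : V) (h : f u ≠ f v)
    (k : {k : ι // k ≠ f v}) (hk : k.1 ≠ f u) :
    fib (merge f u v h) k = fib f k.1 := by
  unfold fib
  congr 1
  ext w
  obtain ⟨k, hk'⟩ := k
  simp only [mem_filter, mem_univ, true_and]
  unfold merge
  split_ifs <;> simp_all <;> grind

lemma merge_prod {V : Type*} [Fintype V] {ι : Type} [Fintype ι] (f : V → ι)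
    (u v : V) (h : f u ≠ f v) :
    (∏ k, fib (merge f u v h) k) * (fib f (f u) * fib f (f v))
      = (fib f (f u) + fib f (f v)) * ∏ k, fib f k := by
  have h1 : ∏ k, fib f k = fib f (f v) * ∏ k : {k : ι // k ≠ f v}, fib f k.1 := by
    rw [← Finset.mul_prod_erase univ _ (mem_univ (f v))]
    congr 1
    exact Finset.prod_subtype _ (by simp) _
  rw [h1, ← Finset.mul_prod_erase univ _ (mem_univ (⟨f u, h⟩ : {k : ι // k ≠ f v})),
    ← Finset.mul_prod_erase univ (fun k : {k : ι // k ≠ f v} => fib f k.1)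
      (mem_univ (⟨f u, h⟩ : {k : ι // k ≠ f v})), merge_fib_u]
  rw [Finset.prod_congr rfl (g := fun k : {k : ι // k ≠ f v} => fib f k.1)]
  · ring
  · intro k hk
    apply merge_fib_ne
    intro h2
    exact (Finset.mem_erase.1 hk).1 (Subtype.ext h2)

lemma isTree_of_card_one {V : Type*} [Nonempty V] {ι : Type} [Fintype ι]
    (hc : Fintype.card ι = 1) (F : SimpleGraph V) (hF : F.IsAcyclic) (f : V → ι)
    (hf : ∀ x y, F.Reachable x y ↔ f x = f y) : F.IsTree := by
  have := Fintype.card_le_one_iff_subsingleton.1 hc.le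
  exact ⟨⟨fun x y => (hf x y).2 (Subsingleton.elim _ _)⟩, hF⟩

lemma not_reach_adj {V : Type*} {ι : Type} {F : SimpleGraph V} {f : V → ι}
    (hf : ∀ x y, F.Reachable x y ↔ f x = f y) {u v : V} (h : f u ≠ f v) : ¬ F.Adj u v :=
  fun h' => h ((hf _ _).1 h'.reachable)

lemma card_edges {V : Type*} [Fintype V] [Nonempty V] (c : ℕ) :
    ∀ (ι : Type) [Fintype ι] (_ : Fintype.card ι = c + 1) (F : SimpleGraph V) (_ : F.IsAcyclic)
      (f : V → ι) (_ : Function.Surjective f) (_ : ∀ x y, F.Reachable x y ↔ f x = f y),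
      F.edgeFinset.card + (c + 1) = Fintype.card V := by
  induction c with
  | zero =>
    intro ι _ hc F hF f hs hf
    exact (isTree_of_card_one hc F hF f hf).card_edgeFinset
  | succ c ih =>
    intro ι _ hc F hF f hs hf
    obtain ⟨i, j, hij⟩ := Fintype.one_lt_card_iff.1 (show 1 < Fintype.card ι by omega)
    obtain ⟨u, rfl⟩ := hs i
    obtain ⟨v, rfl⟩ := hs j
    have hcard : Fintype.card {k : ι // k ≠ f v} = c + 1 := by
      rw [Fintype.card_subtype_compl, Fintype.card_subtype_eq, hc]; rfl
    have := ih _ hcard (F ⊔ SimpleGraph.edge u v)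
      (hF.sup_edge_of_not_reachable (fun h' => hij ((hf _ _).1 h'))) (merge f u v hij)
      (merge_surj f hs u v hij) (merge_reachable F f hf u v hij)
    have h2 := F.card_edgeFinset_sup_edge (not_reach_adj hf hij) (fun h' => hij (congrArg f h'))
    have h3 : F.edgeFinset.card + 1 + (c + 1) = Fintype.card V := by
      rw [← this]
      congr 1
      convert h2.symm
    omega

/-- Ordered crossing pairs in a tree containing the forest. -/
lemma card_cross {V : Type*} [Fintype V] [Nonempty V] (c : ℕ)
    (ι : Type) [Fintype ι] (hc : Fintype.card ι = c + 1) (F : SimpleGraph V) (hF : F.IsAcyclic)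
    (f : V → ι) (hs : Function.Surjective f) (hf : ∀ x y, F.Reachable x y ↔ f x = f y)
    (S : SimpleGraph V) (hS : S.IsTree) (hFS : F ≤ S) :
    (univ.filter (fun p : V × V => f p.1 ≠ f p.2 ∧ S.Adj p.1 p.2)).card = 2 * c := by
  have h1 := card_edges c ι hc F hF f hs hf
  have h2 := hS.card_edgeFinset
  have h3 := F.two_mul_card_edgeFinset
  have h4 := S.two_mul_card_edgeFinset
  have h5 : (univ.filter (fun p : V × V => f p.1 ≠ f p.2 ∧ S.Adj p.1 p.2)).card
      + (univ.filter (fun p : V × V => F.Adj p.1 p.2)).card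
      = (univ.filter (fun p : V × V => S.Adj p.1 p.2)).card := by
    rw [← Finset.card_union_of_disjoint]
    · congr 1
      ext ⟨x, y⟩
      simp only [mem_filter, mem_univ, true_and, mem_union]
      constructor
      · rintro (h | h)
        · exact h.2
        · exact hFS h
      · intro h
        by_cases hxy : f x = f y
        · right
          have hle : F ⊔ SimpleGraph.edge x y ≤ S :=
            sup_le hFS ((SimpleGraph.edge_le_iff S).2 (Or.inr h))
          have := (SimpleGraph.isAcyclic_sup_fromEdgeSet_iff.1 (hS.isAcyclic.anti hle)).2
            ((hf _ _).2 hxy)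
          exact this.resolve_left h.ne
        · exact Or.inl ⟨hxy, h⟩
    · rw [Finset.disjoint_left]
      rintro ⟨x, y⟩
      simp only [mem_filter, mem_univ, true_and]
      intro h h'
      exact not_reach_adj hf h.1 h'
  have h3' : 2 * F.edgeFinset.card = (univ.filter (fun p : V × V => F.Adj p.1 p.2)).card := by
    convert h3
  have h4' : 2 * S.edgeFinset.card = (univ.filter (fun p : V × V => S.Adj p.1 p.2)).card := by
    convert h4
  omega

lemma double_count {V : Type*} [Fintype V] [Nonempty V] (c : ℕ)
    (ι : Type) [Fintype ι] (hc : Fintype.card ι = c + 1) (F : SimpleGraph V) (hF : F.IsAcyclic)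
    (f : V → ι) (hs : Function.Surjective f) (hf : ∀ x y, F.Reachable x y ↔ f x = f y) :
    ∑ p ∈ univ.filter (fun p : V × V => f p.1 ≠ f p.2), numTrees (F ⊔ SimpleGraph.edge p.1 p.2)
      = numTrees F * (2 * c) := by
  have key := Finset.sum_card_bipartiteAbove_eq_sum_card_bipartiteBelow
    (s := univ.filter (fun p : V × V => f p.1 ≠ f p.2))
    (t := univ.filter (fun S : SimpleGraph V => S.IsTree ∧ F ≤ S))
    (fun p S => S.Adj p.1 p.2)
  have hl : ∀ p ∈ univ.filter (fun p : V × V => f p.1 ≠ f p.2),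
      numTrees (F ⊔ SimpleGraph.edge p.1 p.2) = (Finset.bipartiteAbove (fun (p : V × V) S => S.Adj p.1 p.2)
        (univ.filter (fun S : SimpleGraph V => S.IsTree ∧ F ≤ S)) p).card := by
    rintro ⟨x, y⟩ hp
    simp only [mem_filter, mem_univ, true_and] at hp
    unfold numTrees Finset.bipartiteAbove
    rw [Finset.filter_filter]
    congr 1
    ext S
    simp only [mem_filter, mem_univ, true_and, sup_le_iff, SimpleGraph.edge_le_iff]
    have : x ≠ y := fun h => hp (congrArg f h)
    tauto
  rw [Finset.sum_congr rfl hl, key, numTrees, ← smul_eq_mul, ← Finset.sum_const]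
  apply Finset.sum_congr rfl
  intro S hS
  simp only [mem_filter, mem_univ, true_and] at hS
  rw [← card_cross c ι hc F hF f hs hf S hS.1 hS.2, Finset.bipartiteBelow, Finset.filter_filter]

lemma sum_inv {V : Type*} [Fintype V] {ι : Type} [Fintype ι] (f : V → ι)
    (hs : Function.Surjective f) :
    ∑ u, (1 : ℚ) / fib f (f u) = Fintype.card ι := by
  rw [← Finset.sum_fiberwise univ f]
  rw [Finset.sum_congr rfl (g := fun _ => (1 : ℚ))]
  · simp
  · intro k _
    rw [Finset.sum_congr rfl (g := fun _ => (1 : ℚ) / fib f k)]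
    · have : (fib f k : ℚ) ≠ 0 := by exact_mod_cast (fib_pos f hs k).ne'
      rw [Finset.sum_const, nsmul_eq_mul]
      change (fib f k : ℚ) * _ = 1
      field_simp
    · intro u hu
      rw [(mem_filter.1 hu).2]

lemma sum_cross {V : Type*} [Fintype V] {ι : Type} [Fintype ι] (f : V → ι)
    (hs : Function.Surjective f) :
    ∑ p ∈ univ.filter (fun p : V × V => f p.1 ≠ f p.2),
      ((1 : ℚ) / fib f (f p.1) + 1 / fib f (f p.2))
      = 2 * (Fintype.card V * Fintype.card ι - Fintype.card V) := by
  have hone : ∑ p ∈ univ.filter (fun p : V × V => f p.1 ≠ f p.2), ((1 : ℚ) / fib f (f p.1))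
      = Fintype.card V * Fintype.card ι - Fintype.card V := by
    rw [Finset.sum_filter, Fintype.sum_prod_type]
    have : ∀ x : V, ∑ y : V, (if f x ≠ f y then (1 : ℚ) / fib f (f x) else 0)
        = Fintype.card V * (1 / fib f (f x)) - 1 := by
      intro x
      have hx : (fib f (f x) : ℚ) ≠ 0 := by exact_mod_cast (fib_pos f hs (f x)).ne'
      have h1 : ∀ y : V, (if f x ≠ f y then (1 : ℚ) / fib f (f x) else 0)
          = 1 / fib f (f x) - (if f y = f x then (1 : ℚ) / fib f (f x) else 0) := by
        intro y
        by_cases h : f x = f y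
        · simp [h]
        · simp [h, Ne.symm h]
      simp_rw [h1]
      rw [Finset.sum_sub_distrib, ← Finset.sum_filter, Finset.sum_const, Finset.sum_const,
        nsmul_eq_mul, nsmul_eq_mul, Finset.card_univ]
      congr 1
      change (fib f (f x) : ℚ) * _ = 1
      field_simp
    simp_rw [this]
    rw [Finset.sum_sub_distrib, ← Finset.mul_sum, sum_inv f hs]
    simp
  have htwo : ∑ p ∈ univ.filter (fun p : V × V => f p.1 ≠ f p.2), ((1 : ℚ) / fib f (f p.2))
      = ∑ p ∈ univ.filter (fun p : V × V => f p.1 ≠ f p.2), ((1 : ℚ) / fib f (f p.1)) := by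
    apply Finset.sum_nbij' Prod.swap Prod.swap <;> simp <;> grind
  rw [Finset.sum_add_distrib, htwo, hone]
  ring

lemma main {V : Type*} [Fintype V] [Nonempty V] (c : ℕ) :
    ∀ (ι : Type) [Fintype ι] (_ : Fintype.card ι = c + 1) (F : SimpleGraph V) (_ : F.IsAcyclic)
      (f : V → ι) (_ : Function.Surjective f) (_ : ∀ x y, F.Reachable x y ↔ f x = f y),
      numTrees F * Fintype.card V = Fintype.card V ^ c * ∏ k, fib f k := by
  induction c with
  | zero =>
    intro ι _ hc F hF f hs hf
    have hT := isTree_of_card_one hc F hF f hf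
    have h1 : numTrees F = 1 := by
      unfold numTrees
      rw [Finset.card_eq_one]
      refine ⟨F, ?_⟩
      ext S
      simp only [mem_filter, mem_univ, true_and, mem_singleton]
      constructor
      · rintro ⟨h1, h2⟩
        exact le_antisymm ((SimpleGraph.isTree_iff_minimal_connected.1 h1).2 hT.connected h2) h2
      · rintro rfl
        exact ⟨hT, le_rfl⟩
    obtain ⟨k, hk⟩ := Fintype.card_eq_one_iff.1 hc
    have : Unique ι := ⟨⟨k⟩, hk⟩
    have h2 : ∀ k, fib f k = Fintype.card V := by
      intro k
      unfold fib
      rw [Finset.filter_true_of_mem, Finset.card_univ]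
      intro x _
      rw [hk (f x), hk k]
    simp_rw [h1, h2, Finset.prod_const, Finset.card_univ, hc]
    simp
  | succ c ih =>
    intro ι _ hc F hF f hs hf
    have hdc := double_count (c + 1) ι hc F hF f hs hf
    have hcard : ∀ v, Fintype.card {k : ι // k ≠ f v} = c + 1 := by
      intro v
      rw [Fintype.card_subtype_compl, Fintype.card_subtype_eq, hc]; rfl
    have hterm : ∀ p ∈ univ.filter (fun p : V × V => f p.1 ≠ f p.2),
        (numTrees (F ⊔ SimpleGraph.edge p.1 p.2) : ℚ) * Fintype.card V
        = (Fintype.card V ^ c * ∏ k, (fib f k : ℚ)) *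
          ((1 : ℚ) / fib f (f p.1) + 1 / fib f (f p.2)) := by
      rintro ⟨u, v⟩ hp
      simp only [mem_filter, mem_univ, true_and] at hp
      have h1 := ih _ (hcard v) (F ⊔ SimpleGraph.edge u v)
        (hF.sup_edge_of_not_reachable (fun h' => hp ((hf _ _).1 h'))) (merge f u v hp)
        (merge_surj f hs u v hp) (merge_reachable F f hf u v hp)
      have h2 := merge_prod f u v hp
      have hu : (fib f (f u) : ℚ) ≠ 0 := by exact_mod_cast (fib_pos f hs (f u)).ne'
      have hv : (fib f (f v) : ℚ) ≠ 0 := by exact_mod_cast (fib_pos f hs (f v)).ne'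
      have h1' : (numTrees (F ⊔ SimpleGraph.edge u v) : ℚ) * Fintype.card V
        = Fintype.card V ^ c * ((∏ k, fib (merge f u v hp) k : ℕ) : ℚ) := by exact_mod_cast h1
      have h2' : ((∏ k, fib (merge f u v hp) k : ℕ) : ℚ) * (fib f (f u) * fib f (f v))
        = (fib f (f u) + fib f (f v)) * ∏ k, (fib f k : ℚ) := by exact_mod_cast h2
      simp only
      rw [h1']
      field_simp
      linear_combination h2'
    have hsum := Finset.sum_congr rfl hterm
    rw [← Finset.sum_mul, ← Finset.mul_sum, sum_cross f hs, hc] at hsum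
    have hdc' : ∑ p ∈ univ.filter (fun p : V × V => f p.1 ≠ f p.2),
        (numTrees (F ⊔ SimpleGraph.edge p.1 p.2) : ℚ) = numTrees F * (2 * (c + 1)) := by
      exact_mod_cast hdc
    rw [hdc'] at hsum
    push_cast at hsum
    have hne : (2 * ((c : ℚ) + 1)) ≠ 0 := by positivity
    have : (numTrees F : ℚ) * Fintype.card V
        = Fintype.card V ^ (c + 1) * ∏ k, (fib f k : ℚ) := by
      apply mul_right_cancel₀ hne
      linear_combination hsum
    exact_mod_cast this

end GenCayley

/-- **Generalized Cayley formula** (Corollary 8.2).  Let `T 0, …, T (r-1)` be trees with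
pairwise disjoint nonempty vertex sets `A 0, …, A (r-1)` covering a finite vertex type `V`
with `n` elements (each `T i` is a graph on `V` whose edges join vertices of `A i`, which
is acyclic and connected on `A i`).  Then the number `N` of trees on `V` containing all
the `T i` satisfies `N · n = n^(r−1) · ∏ i, |A i|`. -/
theorem generalized_cayley (V : Type*) [Fintype V] [DecidableEq V]
    (r : ℕ) (hr : 1 ≤ r) (A : Fin r → Finset V)
    (hne : ∀ i, (A i).Nonempty)
    (hdisj : ∀ i j, i ≠ j → Disjoint (A i) (A j))
    (hcover : Finset.univ.biUnion A = Finset.univ)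
    (T : Fin r → SimpleGraph V)
    (hsupp : ∀ i u v, (T i).Adj u v → u ∈ A i ∧ v ∈ A i)
    (hacyc : ∀ i, (T i).IsAcyclic)
    (hconn : ∀ i, ∀ u ∈ A i, ∀ v ∈ A i, (T i).Reachable u v) :
    (Finset.univ.filter (fun S : SimpleGraph V => S.IsTree ∧ ∀ i, T i ≤ S)).card
        * Fintype.card V
      = Fintype.card V ^ (r - 1) * ∏ i, (A i).card := by
  have hidx : ∀ v : V, ∃ i, v ∈ A i := by
    intro v
    have : v ∈ Finset.univ.biUnion A := by rw [hcover]; exact mem_univ v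
    simpa using this
  choose f hfA using hidx
  have hfu : ∀ v i, v ∈ A i ↔ f v = i := by
    intro v i
    constructor
    · intro h
      by_contra hne'
      exact Finset.disjoint_left.1 (hdisj _ _ hne') (hfA v) h
    · rintro rfl
      exact hfA v
  have hs : Function.Surjective f := by
    intro i
    obtain ⟨v, hv⟩ := hne i
    exact ⟨v, (hfu v i).1 hv⟩
  obtain ⟨v0, -⟩ := hne ⟨0, hr⟩
  have : Nonempty V := ⟨v0⟩
  have hadj : ∀ i x y, (T i).Adj x y → f x = i ∧ f y = i := by
    intro i x y h
    exact ⟨(hfu _ _).1 (hsupp i x y h).1, (hfu _ _).1 (hsupp i x y h).2⟩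
  have hF : ∀ x y, (⨆ i, T i).Adj x y ↔ ∃ i, (T i).Adj x y := by
    intro x y
    exact SimpleGraph.iSup_adj
  have hreach : ∀ x y, (⨆ i, T i).Reachable x y ↔ f x = f y := by
    intro x y
    constructor
    · apply GenCayley.reachable_of_adj_eq
      intro x y h
      obtain ⟨i, hi⟩ := (hF x y).1 h
      rw [(hadj i x y hi).1, (hadj i x y hi).2]
    · intro h
      exact (hconn (f x) x (hfA x) y (by rw [h]; exact hfA y)).mono (le_iSup T (f x))
  have hac : (⨆ i, T i).IsAcyclic := by
    rw [SimpleGraph.isAcyclic_iff_forall_adj_isBridge]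
    intro u v huv
    obtain ⟨i, hi⟩ := (hF u v).1 huv
    have hb := SimpleGraph.isAcyclic_iff_forall_adj_isBridge.1 (hacyc i) hi
    rw [SimpleGraph.isBridge_iff] at hb ⊢
    intro hr'
    apply hb
    have hgen : ∀ x y, ((⨆ i, T i).deleteEdges {s(u, v)}).Reachable x y → f x = i →
        ((T i).deleteEdges {s(u, v)}).Reachable x y := by
      rintro x y ⟨p⟩
      induction p with
      | nil => intro _; exact SimpleGraph.Reachable.refl _
      | cons h p ih =>
        intro hx
        rw [SimpleGraph.deleteEdges_adj] at h
        obtain ⟨j, hj⟩ := (hF _ _).1 h.1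
        have hj' := hadj j _ _ hj
        have hij : j = i := hj'.1.symm.trans hx
        subst hij
        refine SimpleGraph.Reachable.trans (SimpleGraph.Adj.reachable ?_) (ih hj'.2)
        rw [SimpleGraph.deleteEdges_adj]
        exact ⟨hj, h.2⟩
    exact hgen u v hr' (hadj i u v hi).1
  have hm := GenCayley.main (r - 1) (Fin r) (by simp; omega) (⨆ i, T i) hac f hs hreach
  have hfib : ∀ i, GenCayley.fib f i = (A i).card := by
    intro i
    unfold GenCayley.fib
    congr 1
    ext w
    simp [hfu]
  simp_rw [hfib] at hm
  rw [← hm]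
  unfold GenCayley.numTrees
  simp only [iSup_le_iff]
  congr!
end

section
/- (Kenyon–Wilson all-minors matrix-tree theorem, with corrected overall sign.) Let an electrical network with response matrix C have its set of boundary vertices decomposed into disjoint subsets X = {x_1,…,x_a}, Y = {y_1,…,y_a}, Z, and W = {w_1,…,w_b}, with |X| = |Y| = a (the listed orderings of X, Y, W are arbitrary). Let C_{X,Z}^{Y,Z} denote the block matrix [[C_X^Y, C_X^Z],[C_Z^Y, C_Z^Z]], where C_S^T is the submatrix of C with rows indexed by S and columns by T in the listed orders. Then det C_{X,Z}^{Y,Z} · Σ_H w(H) = (−1)^a · Σ_{π∈S_a} sgn(π) · w(x_1 y_{π(1)} | … | x_a y_{π(a)} | w_1 | … | w_b), where H ranges over all valid forests of the electrical network. -/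
open Finset BigOperators
open scoped Classical

namespace ElecNet

/-- An electrical network with `m` terminals: a finite connected simple graph on `Fin n`
whose boundary vertices are `0, …, m-1`, with symmetric conductances which are positive
exactly on the edges. -/
structure Network where
  n : ℕ
  m : ℕ
  graph : SimpleGraph (Fin n)
  c : Fin n → Fin n → ℝ
  m_pos : 0 < m
  m_le : m ≤ n
  connected : graph.Connected
  c_symm : ∀ k l, c k l = c l k
  c_pos : ∀ k l, graph.Adj k l → 0 < c k l
  c_zero : ∀ k l, ¬ graph.Adj k l → c k l = 0

namespace Network

variable (E : Network)

/-- The type of boundary vertices. -/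
abbrev Bdry := {v : Fin E.n // (v : ℕ) < E.m}

/-- The weight of a subgraph: the product of the conductances of its edges. -/
noncomputable def weight (H : SimpleGraph (Fin E.n)) : ℝ :=
  ∏ e ∈ (Set.toFinite H.edgeSet).toFinset, Sym2.lift ⟨E.c, E.c_symm⟩ e

/-- A spanning forest of the network. -/
def IsSpanningForest (H : SimpleGraph (Fin E.n)) : Prop := H ≤ E.graph ∧ H.IsAcyclic

/-- A valid forest of the electrical network: a spanning forest each of whose components
contains exactly one boundary vertex. -/
def IsValidForest (H : SimpleGraph (Fin E.n)) : Prop :=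
  E.IsSpanningForest H ∧
    ∀ comp : H.ConnectedComponent,
      (Finset.univ.filter
        (fun v : Fin E.n => (v : ℕ) < E.m ∧ H.connectedComponentMk v = comp)).card = 1

/-- `C` is the response matrix of the electrical network: for any voltages and currents
satisfying axioms (C) and (I), the incoming currents at the boundary vertices are obtained
from the prescribed boundary voltages by multiplication by `C`. -/
def IsResponse (C : Matrix E.Bdry E.Bdry ℝ) : Prop :=
  ∀ (Ub : E.Bdry → ℝ) (U : Fin E.n → ℝ) (I : Fin E.n → Fin E.n → ℝ),
    (∀ k l, I k l = E.c k l * (U k - U l)) →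
    (∀ k : Fin E.n, E.m ≤ (k : ℕ) → ∑ l, I k l = 0) →
    (∀ v : E.Bdry, U v.1 = Ub v) →
    ∀ v : E.Bdry, (∑ l, I v.1 l) = ∑ u : E.Bdry, C v u * Ub u

end Network
end ElecNet

namespace ElecNet

section Functional
variable {V : Type*}

/-- The undirected graph of a self-map. -/
def gr (g : V → V) : SimpleGraph V := SimpleGraph.fromRel (fun u v => g u = v)

lemma gr_adj (g : V → V) (u v : V) : (gr g).Adj u v ↔ u ≠ v ∧ (g u = v ∨ g v = u) := by
  simp [gr]

variable {S : Set V} {g : V → V}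

lemma no_cycle (hS : ∀ s ∈ S, g s = s) (hg : ∀ v, ∃ k, g^[k] v ∈ S) {v : V} {k : ℕ}
    (h : g^[k+1] v = v) : v ∈ S := by
  obtain ⟨K, hK⟩ := hg v
  have h1 : g^[(k+1)*K] v = v := by
    rw [Function.iterate_mul]; exact Function.iterate_fixed h K
  have h2 : (k+1)*K = k*K + K := by ring
  rw [h2, Function.iterate_add_apply, Function.iterate_fixed (hS _ hK)] at h1
  rwa [h1] at hK

lemma gr_acyclic (hS : ∀ s ∈ S, g s = s) (hg : ∀ v, ∃ k, g^[k] v ∈ S) : (gr g).IsAcyclic := by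
  rw [SimpleGraph.isAcyclic_iff_forall_adj_isBridge]
  have key : ∀ v, v ≠ g v → ¬ ((gr g) \ SimpleGraph.fromEdgeSet {s(v, g v)}).Reachable v (g v) := by
    intro v hv hr
    have inv : ∀ u w, ((gr g) \ SimpleGraph.fromEdgeSet {s(v, g v)}).Reachable u w →
        (∃ k, g^[k] u = v) → ∃ k, g^[k] w = v := by
      rintro u w ⟨p⟩
      induction p with
      | nil => exact id
      | cons hadj p ih =>
        rename_i u u' w
        intro ⟨k, hk⟩
        apply ih
        rw [SimpleGraph.sdiff_adj, gr_adj, SimpleGraph.fromEdgeSet_adj] at hadj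
        obtain ⟨⟨hne, h⟩, hn⟩ := hadj
        rcases h with h | h
        · cases k with
          | zero =>
            simp only [Function.iterate_zero, id] at hk
            subst hk; subst h
            exact absurd ⟨rfl, hne⟩ hn
          | succ k =>
            refine ⟨k, ?_⟩
            rw [Function.iterate_succ_apply, h] at hk
            exact hk
        · exact ⟨k+1, by rw [Function.iterate_succ_apply, h]; exact hk⟩
    obtain ⟨k, hk⟩ := inv _ _ hr ⟨0, rfl⟩
    have : v ∈ S := no_cycle hS hg (k := k) (by rw [Function.iterate_succ_apply]; exact hk)
    exact hv (hS v this).symm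
  intro u v huv
  rw [SimpleGraph.isBridge_iff]
  rw [gr_adj] at huv
  obtain ⟨hne, h | h⟩ := huv
  · subst h
    exact key u hne
  · subst h
    rw [Sym2.eq_swap]
    exact fun h => key v hne.symm h.symm

lemma gr_reach_iter (v : V) (k : ℕ) : (gr g).Reachable v (g^[k] v) := by
  induction k with
  | zero => exact SimpleGraph.Reachable.refl _
  | succ k ih =>
    refine ih.trans ?_
    rw [Function.iterate_succ_apply']
    by_cases h : g^[k] v = g (g^[k] v)
    · rw [← h]
    · exact SimpleGraph.Adj.reachable ((gr_adj _ _ _).2 ⟨h, Or.inl rfl⟩)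

lemma gr_root (hS : ∀ s ∈ S, g s = s) {u v s : V} (h : (gr g).Reachable u v) (hs : s ∈ S)
    (hu : ∃ k, g^[k] u = s) : ∃ k, g^[k] v = s := by
  obtain ⟨p⟩ := h
  induction p with
  | nil => exact hu
  | cons hadj p ih =>
    apply ih
    obtain ⟨k, hk⟩ := hu
    rw [gr_adj] at hadj
    obtain ⟨hne, h | h⟩ := hadj
    · cases k with
      | zero =>
        simp only [Function.iterate_zero, id] at hk
        subst hk; rw [hS _ hs] at h
        exact ⟨0, h.symm⟩
      | succ k =>
        refine ⟨k, ?_⟩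
        rw [Function.iterate_succ_apply, h] at hk
        exact hk
    · exact ⟨k+1, by rw [Function.iterate_succ_apply, h]; exact hk⟩

lemma gr_reach_iff (hS : ∀ s ∈ S, g s = s) {v s : V} (hs : s ∈ S) :
    (gr g).Reachable v s ↔ ∃ k, g^[k] v = s := by
  constructor
  · intro h
    exact gr_root hS h.symm hs ⟨0, rfl⟩
  · rintro ⟨k, rfl⟩
    exact gr_reach_iter v k

lemma iter_unique (hS : ∀ s ∈ S, g s = s) {v s t : V} (hs : s ∈ S) (ht : t ∈ S)
    (h1 : ∃ k, g^[k] v = s) (h2 : ∃ k, g^[k] v = t) : s = t := by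
  obtain ⟨k, rfl⟩ := h1
  obtain ⟨l, rfl⟩ := h2
  rcases le_total k l with h | h
  · obtain ⟨d, rfl⟩ := Nat.exists_eq_add_of_le' h
    rw [Function.iterate_add_apply, Function.iterate_fixed (hS _ hs)]
  · obtain ⟨d, rfl⟩ := Nat.exists_eq_add_of_le' h
    rw [Function.iterate_add_apply, Function.iterate_fixed (hS _ ht)]

lemma gr_exists_unique (hS : ∀ s ∈ S, g s = s) (hg : ∀ v, ∃ k, g^[k] v ∈ S) (v : V) :
    ∃! s, s ∈ S ∧ (gr g).Reachable v s := by
  obtain ⟨k, hk⟩ := hg v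
  refine ⟨g^[k] v, ⟨hk, gr_reach_iter v k⟩, ?_⟩
  rintro t ⟨ht, h⟩
  exact iter_unique hS ht hk ((gr_reach_iff hS ht).1 h) ⟨k, rfl⟩

lemma gr_inj {g' : V → V} (hS : ∀ s ∈ S, g s = s) (hg : ∀ v, ∃ k, g^[k] v ∈ S)
    (hS' : ∀ s ∈ S, g' s = s) (h : gr g = gr g') : g = g' := by
  funext v
  by_cases hv : v ∈ S
  · rw [hS v hv, hS' v hv]
  by_contra hne
  have step : ∀ u, u ∉ S → g u ≠ g' u → g' (g u) = u := by
    intro u hu hne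
    have h1 : u ≠ g u := fun e => hu (no_cycle hS hg (k := 0) e.symm)
    have h2 : (gr g).Adj u (g u) := (gr_adj _ _ _).2 ⟨h1, Or.inl rfl⟩
    rw [h, gr_adj] at h2
    rcases h2.2 with h3 | h3
    · exact absurd h3.symm hne
    · exact h3
  have claim : ∀ k, g^[k] v ∉ S ∧ g' (g^[k+1] v) = g^[k] v := by
    intro k
    induction k with
    | zero => exact ⟨hv, step v hv hne⟩
    | succ k ih =>
      obtain ⟨h1, h2⟩ := ih
      have h3 : g^[k+1] v ∉ S := by
        intro h3
        rw [hS' _ h3] at h2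
        rw [h2] at h3
        exact h1 h3
      refine ⟨h3, ?_⟩
      rw [Function.iterate_succ_apply' g (k+1)]
      apply step _ h3
      rw [h2, Function.iterate_succ_apply']
      intro h4
      exact h1 (no_cycle hS hg (k := 1) h4)
  obtain ⟨K, hK⟩ := hg v
  exact (claim K).1 hK

lemma exists_closer {H : SimpleGraph V} {v s : V} (h : H.Reachable v s) (hne : v ≠ s) :
    ∃ w, H.Adj v w ∧ H.dist w s + 1 ≤ H.dist v s := by
  obtain ⟨p, hp⟩ := h.exists_walk_length_eq_dist
  cases p with
  | nil => exact absurd rfl hne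
  | cons hadj q =>
    rename_i w
    refine ⟨w, hadj, ?_⟩
    rw [SimpleGraph.Walk.length_cons] at hp
    have h1 := SimpleGraph.dist_le q
    omega

lemma gr_surj {H : SimpleGraph V} (hH : H.IsAcyclic)
    (hu : ∀ v, ∃! s, s ∈ S ∧ H.Reachable v s) :
    ∃ g : V → V, (∀ s ∈ S, g s = s) ∧ (∀ v, ∃ k, g^[k] v ∈ S) ∧ gr g = H ∧
      ∀ v, v ∉ S → H.Adj v (g v) := by
  choose ρ hρ hρu using hu
  have hnext : ∀ v, ∃ w, (v ∈ S → w = v) ∧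
      (v ∉ S → H.Adj v w ∧ H.dist w (ρ v) + 1 ≤ H.dist v (ρ v)) := by
    intro v
    by_cases hv : v ∈ S
    · exact ⟨v, fun _ => rfl, fun h => absurd hv h⟩
    · obtain ⟨w, hw⟩ := exists_closer (hρ v).2 (fun h => hv (h ▸ (hρ v).1))
      exact ⟨w, fun h => absurd h hv, fun _ => hw⟩
  choose g hg1 hg2 using hnext
  have hSg : ∀ s ∈ S, g s = s := hg1
  have hroot : ∀ v, ρ (g v) = ρ v := by
    intro v
    by_cases hv : v ∈ S
    · rw [hSg v hv]
    · exact (hρu (g v) (ρ v) ⟨(hρ v).1, ((hg2 v hv).1.reachable.symm).trans (hρ v).2⟩).symm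
  have hreach : ∀ d v, H.dist v (ρ v) ≤ d → ∃ k, g^[k] v ∈ S := by
    intro d
    induction d with
    | zero =>
      intro v hv
      refine ⟨0, ?_⟩
      by_contra h
      have := (hg2 v h).2
      omega
    | succ d ih =>
      intro v hv
      by_cases h : v ∈ S
      · exact ⟨0, h⟩
      · have := (hg2 v h).2
        obtain ⟨k, hk⟩ := ih (g v) (by rw [hroot]; omega)
        exact ⟨k+1, hk⟩
  have hreach' : ∀ v, ∃ k, g^[k] v ∈ S := fun v => hreach _ v le_rfl
  have hle : gr g ≤ H := by
    intro u v huv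
    rw [gr_adj] at huv
    obtain ⟨hne, h | h⟩ := huv
    · have : u ∉ S := fun hu => hne (by rw [← h, hSg u hu])
      rw [← h]; exact (hg2 u this).1
    · have : v ∉ S := fun hu => hne (by rw [← h, hSg v hu])
      rw [← h]; exact (hg2 v this).1.symm
  refine ⟨g, hSg, hreach', ?_, fun v hv => (hg2 v hv).1⟩
  apply le_antisymm hle
  have hr : ∀ v, (gr g).Reachable v (ρ v) := by
    intro v
    obtain ⟨k, hk⟩ := hreach' v
    have h1 := gr_reach_iter (g := g) v k
    have := hρu v _ ⟨hk, h1.mono hle⟩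
    rw [← this]; exact h1
  intro u v huv
  by_contra hn
  rw [SimpleGraph.isAcyclic_iff_forall_adj_isBridge] at hH
  have hb := hH huv
  rw [SimpleGraph.isBridge_iff] at hb
  apply hb
  have hρuv : ρ u = ρ v := hρu v (ρ u) ⟨(hρ u).1, huv.symm.reachable.trans (hρ u).2⟩
  have h1 : (gr g).Reachable u v := (hr u).trans (hρuv ▸ (hr v).symm)
  refine h1.mono ?_
  intro a b hab
  rw [SimpleGraph.deleteEdges_adj]
  refine ⟨hle hab, ?_⟩
  intro h
  have h' : s(a,b) = s(u,v) := h
  apply hn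
  rw [← SimpleGraph.mem_edgeSet, ← h', SimpleGraph.mem_edgeSet]
  exact hab
end Functional

section Sums

/-- Real-valued indicator. -/
noncomputable def ind (Q : Prop) : ℝ := if Q then 1 else 0

lemma ind_pos {Q : Prop} (h : Q) : ind Q = 1 := if_pos h
lemma ind_neg {Q : Prop} (h : ¬ Q) : ind Q = 0 := if_neg h
lemma ind_congr {Q Q' : Prop} (h : Q ↔ Q') : ind Q = ind Q' := by rw [propext h]

variable {V P : Type*}

/-- Extension of `f` along `e` by the identity. -/
noncomputable def extf (e : P → V) (f : P → V) (v : V) : V :=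
  if h : ∃ p, e p = v then f h.choose else v

lemma extf_apply {e : P → V} (he : Function.Injective e) (f : P → V) (p : P) :
    extf e f (e p) = f p := by
  have h : ∃ q, e q = e p := ⟨p, rfl⟩
  rw [extf, dif_pos h, he h.choose_spec]

lemma extf_of_not {e : P → V} (f : P → V) {v : V} (h : v ∉ Set.range e) : extf e f v = v := by
  rw [extf, dif_neg (by simpa using h)]

/-- Weight of a graph. -/
noncomputable def wt [Finite V] (c : V → V → ℝ) (hc : ∀ k l, c k l = c l k) (H : SimpleGraph V) : ℝ :=
  ∏ e ∈ (Set.toFinite H.edgeSet).toFinset, Sym2.lift ⟨c, hc⟩ e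

lemma wt_gr [Fintype V] [Fintype P] (c : V → V → ℝ) (hc : ∀ k l, c k l = c l k) {e : P → V}
    (he : Function.Injective e) (f : P → V)
    (hg : ∀ v, ∃ k, (extf e f)^[k] v ∈ (Set.range e)ᶜ) :
    wt c hc (gr (extf e f)) = ∏ p, c (e p) (f p) := by
  have hS : ∀ s ∈ (Set.range e)ᶜ, extf e f s = s := fun s hs => extf_of_not f hs
  have hset : (Set.toFinite (gr (extf e f)).edgeSet).toFinset
      = Finset.univ.image (fun p => s(e p, f p)) := by
    ext z
    induction z using Sym2.ind with
    | _ u v =>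
    simp only [Set.Finite.mem_toFinset, SimpleGraph.mem_edgeSet, Finset.mem_image,
      Finset.mem_univ, true_and, gr_adj]
    constructor
    · rintro ⟨hne, h | h⟩
      · have : u ∈ Set.range e := by
          by_contra hu
          exact hne (by rw [← h, hS u hu])
        obtain ⟨p, rfl⟩ := this
        rw [extf_apply he] at h
        exact ⟨p, by rw [h]⟩
      · have : v ∈ Set.range e := by
          by_contra hu
          exact hne (by rw [← h, hS v hu])
        obtain ⟨p, rfl⟩ := this
        rw [extf_apply he] at h
        exact ⟨p, by rw [h, Sym2.eq_swap]⟩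
    · rintro ⟨p, hp⟩
      have hne : e p ≠ f p := by
        intro h
        exact (no_cycle hS hg (v := e p) (k := 0) (by simp [extf_apply he, ← h])) ⟨p, rfl⟩
      rw [Sym2.eq_iff] at hp
      rcases hp with ⟨rfl, rfl⟩ | ⟨rfl, rfl⟩
      · exact ⟨hne, Or.inl (extf_apply he f p)⟩
      · exact ⟨hne.symm, Or.inr (extf_apply he f p)⟩
  rw [wt, hset, Finset.prod_image]
  · simp
  · intro p _ q _ hpq
    simp only [Sym2.eq_iff] at hpq
    rcases hpq with ⟨h, -⟩ | ⟨h1, h2⟩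
    · exact he h
    · exfalso
      refine (no_cycle hS hg (v := e p) (k := 1) ?_) ⟨p, rfl⟩
      change extf e f (extf e f (e p)) = e p
      rw [extf_apply he, h2, extf_apply he, h1]

lemma sum_forest [Fintype V] [Fintype P] (c : V → V → ℝ) (hc : ∀ k l, c k l = c l k)
    (G : SimpleGraph V) (hG : ∀ k l, ¬ G.Adj k l → c k l = 0) {e : P → V}
    (he : Function.Injective e) (Q : (V → V) → Prop) (Q' : SimpleGraph V → Prop)
    (hQ : ∀ g : V → V, (∀ s ∈ (Set.range e)ᶜ, g s = s) → (Q g ↔ Q' (gr g))) :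
    ∑ f : P → V, (∏ p, c (e p) (f p)) *
        ind ((∀ v, ∃ k, (extf e f)^[k] v ∈ (Set.range e)ᶜ) ∧ Q (extf e f))
      = ∑ H ∈ Finset.univ.filter (fun H : SimpleGraph V => (H ≤ G ∧ H.IsAcyclic) ∧
          (∀ v, ∃! s, s ∈ (Set.range e)ᶜ ∧ H.Reachable v s) ∧ Q' H), wt c hc H := by
  have hS : ∀ f : P → V, ∀ s ∈ (Set.range e)ᶜ, extf e f s = s := fun f s hs => extf_of_not f hs
  have h1 : ∑ f : P → V, (∏ p, c (e p) (f p)) *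
        ind ((∀ v, ∃ k, (extf e f)^[k] v ∈ (Set.range e)ᶜ) ∧ Q (extf e f))
      = ∑ f ∈ Finset.univ.filter (fun f : P → V => (∀ p, G.Adj (e p) (f p)) ∧
        (∀ v, ∃ k, (extf e f)^[k] v ∈ (Set.range e)ᶜ) ∧ Q (extf e f)), ∏ p, c (e p) (f p) := by
    rw [Finset.sum_filter]
    refine Finset.sum_congr rfl fun f _ => ?_
    by_cases h : ∀ p, G.Adj (e p) (f p)
    · by_cases h' : (∀ v, ∃ k, (extf e f)^[k] v ∈ (Set.range e)ᶜ) ∧ Q (extf e f)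
      · rw [ind_pos h', if_pos ⟨h, h'⟩, mul_one]
      · rw [ind_neg h', if_neg (fun h => h' h.2), mul_zero]
    · rw [if_neg (fun h' => h h'.1)]
      push Not at h
      obtain ⟨p, hp⟩ := h
      rw [Finset.prod_eq_zero (Finset.mem_univ p) (hG _ _ hp), zero_mul]
  rw [h1]
  refine Finset.sum_bij (fun f _ => gr (extf e f)) ?_ ?_ ?_ ?_
  · intro f hf
    simp only [Finset.mem_filter, Finset.mem_univ, true_and] at hf ⊢
    obtain ⟨ha, hg, hq⟩ := hf
    refine ⟨⟨?_, gr_acyclic (hS f) hg⟩, gr_exists_unique (hS f) hg, (hQ _ (hS f)).1 hq⟩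
    intro u v huv
    rw [gr_adj] at huv
    obtain ⟨hne, h | h⟩ := huv
    · have : u ∈ Set.range e := by
        by_contra hu
        exact hne (by rw [← h, hS f u hu])
      obtain ⟨p, rfl⟩ := this
      rw [← h, extf_apply he]; exact ha p
    · have : v ∈ Set.range e := by
        by_contra hu
        exact hne (by rw [← h, hS f v hu])
      obtain ⟨p, rfl⟩ := this
      rw [← h, extf_apply he]; exact (ha p).symm
  · intro f hf f' hf' h
    simp only [Finset.mem_filter, Finset.mem_univ, true_and] at hf hf'
    have := gr_inj (hS f) hf.2.1 (hS f') h
    funext p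
    rw [← extf_apply he f p, this, extf_apply he]
  · intro H hH
    simp only [Finset.mem_filter, Finset.mem_univ, true_and] at hH
    obtain ⟨⟨hle, hac⟩, hu, hq⟩ := hH
    obtain ⟨g, hg1, hg2, hg3, hg4⟩ := gr_surj hac hu
    have hext : extf e (fun p => g (e p)) = g := by
      funext v
      by_cases hv : v ∈ Set.range e
      · obtain ⟨p, rfl⟩ := hv
        rw [extf_apply he]
      · rw [extf_of_not _ hv, hg1 v hv]
    refine ⟨fun p => g (e p), ?_, ?_⟩
    · simp only [Finset.mem_filter, Finset.mem_univ, true_and, hext]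
      refine ⟨fun p => hle (hg4 _ (fun h => h ⟨p, rfl⟩)), hg2, (hQ g hg1).2 (hg3 ▸ hq)⟩
    · simp only [hext, hg3]
  · intro f hf
    simp only [Finset.mem_filter, Finset.mem_univ, true_and] at hf
    exact (wt_gr c hc he f hf.2.1).symm

end Sums

section Det

variable {V ρ : Type*} [Fintype V] [Fintype ρ] [DecidableEq ρ] {a : ℕ}

lemma det_expand {ι : Type*} [Fintype ι] [DecidableEq ι] (c : V → V → ℝ) (rv cv : ι → V) :
    (Matrix.of fun p q : ι => ∑ v, c (rv p) v * (ind (rv p = cv q) - ind (v = cv q))).det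
      = ∑ f : ι → V, (∏ p, c (rv p) (f p)) *
        (Matrix.of fun p q : ι => ind (rv p = cv q) - ind (f p = cv q)).det := by
  have h : (Matrix.of fun p q : ι => ∑ v, c (rv p) v * (ind (rv p = cv q) - ind (v = cv q)))
      = fun p => ∑ v : V, c (rv p) v • (fun q => ind (rv p = cv q) - ind (v = cv q)) := by
    funext p q
    simp [Finset.sum_apply]
  have h2 := (Matrix.detRowAlternating (n := ι) (R := ℝ)).toMultilinearMap.map_sum
    (fun p (v : V) => c (rv p) v • (fun q : ι => ind (rv p = cv q) - ind (v = cv q)))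
  rw [h]
  refine h2.trans ?_
  refine Finset.sum_congr rfl fun f _ => ?_
  exact (Matrix.detRowAlternating (n := ι) (R := ℝ)).toMultilinearMap.map_smul_univ
    (fun p => c (rv p) (f p)) (fun p => (fun q : ι => ind (rv p = cv q) - ind (f p = cv q)))

lemma sum_ind (r : ρ → V) (hr : Function.Injective r) (v : V) (F : V → ℝ) :
    ∑ q, ind (v = r q) * F (r q) = ind (v ∈ Set.range r) * F v := by
  by_cases h : v ∈ Set.range r
  · obtain ⟨q, rfl⟩ := h
    rw [Finset.sum_eq_single q]
    · rw [ind_pos rfl, ind_pos ⟨q, rfl⟩]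
    · intro b _ hb
      rw [ind_neg (fun h => hb (hr h.symm)), zero_mul]
    · simp
  · rw [ind_neg h, zero_mul]
    refine Finset.sum_eq_zero fun q _ => ?_
    rw [ind_neg (fun h' => h ⟨q, h'.symm⟩), zero_mul]

/-- stopping map hits `t` -/
def hit (r : ρ → V) (φ : ρ → V) (v t : V) : Prop := ∃ k, (extf r φ)^[k] v = t

lemma hit_split (r φ : ρ → V) (hr : Function.Injective r) (v t : V) (ht : t ∉ Set.range r) :
    ind (hit r φ v t) = ind (v = t) + ∑ q, ind (v = r q) * ind (hit r φ (r q) t) := by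
  rw [sum_ind r hr v (fun u => ind (hit r φ u t))]
  by_cases h : v ∈ Set.range r
  · rw [ind_pos h, ind_neg (Q := v = t) (fun e => ht (e ▸ h))]; ring
  · rw [ind_neg h, zero_mul, add_zero]
    apply ind_congr
    constructor
    · rintro ⟨k, rfl⟩
      rw [Function.iterate_fixed (extf_of_not φ h)]
    · rintro rfl
      exact ⟨0, rfl⟩

lemma hit_step (r φ : ρ → V) (hr : Function.Injective r) (q : ρ) (t : V) (ht : t ∉ Set.range r) :
    hit r φ (r q) t ↔ hit r φ (φ q) t := by
  constructor
  · rintro ⟨k, hk⟩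
    cases k with
    | zero => exact absurd ⟨q, hk⟩ ht
    | succ k =>
      rw [Function.iterate_succ_apply, extf_apply hr] at hk
      exact ⟨k, hk⟩
  · rintro ⟨k, hk⟩
    exact ⟨k+1, by rw [Function.iterate_succ_apply, extf_apply hr]; exact hk⟩

lemma det_D (r φ : ρ → V) (hr : Function.Injective r)
    (hgood : ∀ v, ∃ k, (extf r φ)^[k] v ∉ Set.range r) :
    (Matrix.of fun q q' : ρ => ind (r q = r q') - ind (φ q = r q')).det = 1 := by
  have hrk : ∃ rk : V → ℕ, ∀ q q', φ q = r q' → rk (r q') < rk (r q) := by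
    refine ⟨fun v => Nat.find (hgood v), fun q q' h => ?_⟩
    have h1 := Nat.find_spec (hgood (r q))
    dsimp only
    generalize hk : Nat.find (hgood (r q)) = k at *
    cases k with
    | zero => exact absurd ⟨q, rfl⟩ h1
    | succ k =>
      rw [Function.iterate_succ_apply, extf_apply hr, h] at h1
      exact Nat.lt_succ_of_le (Nat.find_min' _ h1)
  obtain ⟨rk, hrk⟩ := hrk
  have hoff : ∀ q q', q ≠ q' → rk (r q) ≤ rk (r q') → ind (r q = r q') - ind (φ q = r q') = 0 := by
    intro q q' hne hle
    rw [ind_neg (fun h => hne (hr h)), ind_neg, sub_zero]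
    intro h
    have := hrk q q' h
    omega
  have hbt : (Matrix.of fun q q' : ρ => ind (r q = r q') - ind (φ q = r q')).BlockTriangular
      (fun q => OrderDual.toDual (rk (r q))) := by
    intro i j hij
    have hij' : rk (r i) < rk (r j) := hij
    refine hoff i j ?_ hij'.le
    rintro rfl
    exact lt_irrefl _ hij'
  rw [hbt.det]
  refine Finset.prod_eq_one fun k _ => ?_
  have : (Matrix.of fun q q' : ρ => ind (r q = r q') - ind (φ q = r q')).toSquareBlock
      (fun q => OrderDual.toDual (rk (r q))) k = 1 := by
    ext ⟨i, hi⟩ ⟨j, hj⟩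
    simp only [Matrix.toSquareBlock_def, Matrix.of_apply]
    by_cases hne : i = j
    · subst hne
      rw [Matrix.one_apply_eq, ind_pos rfl, ind_neg, sub_zero]
      intro h
      exact lt_irrefl _ (hrk i i h)
    · rw [Matrix.one_apply_ne (by simpa using hne)]
      refine hoff i j hne ?_
      have : OrderDual.toDual (rk (r i)) = OrderDual.toDual (rk (r j)) := hi.trans hj.symm
      exact (OrderDual.toDual_inj.1 this).le
  rw [this, Matrix.det_one]

lemma det_Mf (x y : Fin a → V) (r : ρ → V) (hrv : Function.Injective (Sum.elim x r))
    (hy : ∀ j, y j ∉ Set.range (Sum.elim x r)) (f : Fin a ⊕ ρ → V) :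
    (Matrix.of fun p q : Fin a ⊕ ρ =>
        ind (Sum.elim x r p = Sum.elim y r q) - ind (f p = Sum.elim y r q)).det
      = (-1) ^ a * ∑ π : Equiv.Perm (Fin a), ((Equiv.Perm.sign π : ℤ) : ℝ) *
        ind ((∀ v, ∃ k, (extf r (f ∘ Sum.inr))^[k] v ∉ Set.range r) ∧
          ∀ i, hit r (f ∘ Sum.inr) (f (Sum.inl i)) (y (π i))) := by
  have hr : Function.Injective r := fun p q h => by
    have := @hrv (Sum.inr p) (Sum.inr q) h
    simpa using this
  have hxr : ∀ i q, x i ≠ r q := fun i q h => by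
    have := @hrv (Sum.inl i) (Sum.inr q) h
    simp at this
  have hyx : ∀ i j, x i ≠ y j := fun i j h => hy j ⟨Sum.inl i, h⟩
  have hyr' : ∀ j, y j ∉ Set.range r := fun j ⟨q, h⟩ => hy j ⟨Sum.inr q, h⟩
  have hyr : ∀ j q, r q ≠ y j := fun j q h => hyr' j ⟨q, h⟩
  set φ := f ∘ Sum.inr with hφ
  by_cases hgood : ∀ v, ∃ k, (extf r φ)^[k] v ∉ Set.range r
  · have hM : (Matrix.of fun p q : Fin a ⊕ ρ =>
        ind (Sum.elim x r p = Sum.elim y r q) - ind (f p = Sum.elim y r q))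
        = Matrix.fromBlocks
          (Matrix.of fun i j : Fin a => - ind (f (Sum.inl i) = y j))
          (Matrix.of fun (i : Fin a) (q : ρ) => - ind (f (Sum.inl i) = r q))
          (Matrix.of fun (q : ρ) (j : Fin a) => - ind (φ q = y j))
          (Matrix.of fun q q' : ρ => ind (r q = r q') - ind (φ q = r q')) := by
      ext p q
      rcases p with i | p <;> rcases q with j | q
      · simp [ind_neg (hyx i j)]
      · simp [ind_neg (hxr i q)]
      · simp [ind_neg (hyr j p), φ]
      · simp [φ]
    have hD := det_D r φ hr hgood
    rw [hM]
    set D := (Matrix.of fun q q' : ρ => ind (r q = r q') - ind (φ q = r q')) with hDdef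
    have : Invertible D := Matrix.invertibleOfIsUnitDet D (by rw [hD]; exact isUnit_one)
    rw [Matrix.det_fromBlocks₂₂, hD, one_mul]
    let T : Matrix ρ (Fin a) ℝ := Matrix.of fun q j => ind (hit r φ (r q) (y j))
    have hT : (Matrix.of fun (q : ρ) (j : Fin a) => - ind (φ q = y j)) = D * (-T) := by
      ext q j
      rw [Matrix.mul_apply]
      simp only [Matrix.of_apply, Matrix.neg_apply, T, D, sub_mul, mul_neg, Finset.sum_sub_distrib,
        Finset.sum_neg_distrib]
      rw [sum_ind r hr (r q) (fun v => ind (hit r φ v (y j))), ind_pos (Q := r q ∈ Set.range r) ⟨q, rfl⟩]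
      have := hit_split r φ hr (φ q) (y j) (hyr' j)
      rw [ind_congr (hit_step r φ hr q (y j) (hyr' j)), this]
      ring
    have hK : (Matrix.of fun i j : Fin a => - ind (f (Sum.inl i) = y j)) -
        (Matrix.of fun (i : Fin a) (q : ρ) => - ind (f (Sum.inl i) = r q)) * ⅟D *
          (Matrix.of fun (q : ρ) (j : Fin a) => - ind (φ q = y j))
        = - (Matrix.of fun i j : Fin a => ind (hit r φ (f (Sum.inl i)) (y j))) := by
      rw [hT, Matrix.mul_assoc, Matrix.invOf_mul_cancel_left]
      ext i j
      simp only [Matrix.sub_apply, Matrix.mul_apply, Matrix.of_apply, Matrix.neg_apply, T,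
        neg_mul_neg]
      rw [hit_split r φ hr (f (Sum.inl i)) (y j) (hyr' j)]
      ring
    rw [hK, Matrix.det_neg, Fintype.card_fin, ← Matrix.det_transpose, Matrix.det_apply']
    congr 1
    refine Finset.sum_congr rfl fun π _ => ?_
    congr 1
    simp only [Matrix.transpose_apply, Matrix.of_apply]
    by_cases h : ∀ i, hit r φ (f (Sum.inl i)) (y (π i))
    · rw [ind_pos ⟨hgood, h⟩]
      exact Finset.prod_eq_one fun i _ => ind_pos (h i)
    · rw [ind_neg (fun h' => h h'.2)]
      push Not at h
      obtain ⟨i, hi⟩ := h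
      exact Finset.prod_eq_zero (Finset.mem_univ i) (ind_neg hi)
  · have h0 : ∀ π : Equiv.Perm (Fin a), ind ((∀ v, ∃ k, (extf r φ)^[k] v ∉ Set.range r) ∧
          ∀ i, hit r φ (f (Sum.inl i)) (y (π i))) = 0 := fun π => ind_neg (fun h => hgood h.1)
    simp only [h0, mul_zero, Finset.sum_const_zero]
    push Not at hgood
    obtain ⟨v, hv⟩ := hgood
    choose o ho using hv
    have hstep : ∀ k, φ (o k) = r (o (k+1)) := by
      intro k
      rw [ho (k+1), Function.iterate_succ_apply', ← ho k, extf_apply hr]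
    have hninj : ¬ Function.Injective o := not_injective_infinite_finite o
    have : ∃ i j, i < j ∧ o i = o j := by
      rw [Function.Injective] at hninj
      push Not at hninj
      obtain ⟨i, j, h, hne⟩ := hninj
      rcases lt_or_gt_of_ne hne with h' | h'
      · exact ⟨i, j, h', h⟩
      · exact ⟨j, i, h', h.symm⟩
    obtain ⟨i, j, hij, hoij⟩ := this
    rw [← Matrix.exists_vecMul_eq_zero_iff]
    refine ⟨fun p => ∑ k ∈ Finset.Ico i j, ind (p = Sum.inr (o k)), ?_, ?_⟩
    · intro h
      have h1 := congrFun h (Sum.inr (o i))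
      have h2 : (1:ℝ) ≤ ∑ k ∈ Finset.Ico i j, ind ((Sum.inr (o i) : Fin a ⊕ ρ) = Sum.inr (o k)) := by
        calc (1:ℝ) = ind ((Sum.inr (o i) : Fin a ⊕ ρ) = Sum.inr (o i)) := (ind_pos rfl).symm
          _ ≤ _ := Finset.single_le_sum
            (f := fun k => ind ((Sum.inr (o i) : Fin a ⊕ ρ) = Sum.inr (o k)))
            (fun k _ => by unfold ind; split_ifs <;> norm_num) (Finset.left_mem_Ico.2 hij)
      rw [Pi.zero_apply] at h1
      linarith
    · funext q
      simp only [Matrix.vecMul, dotProduct, Matrix.of_apply, Pi.zero_apply, Finset.sum_mul]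
      rw [Finset.sum_comm]
      have : ∀ k, ∑ p : Fin a ⊕ ρ, ind (p = Sum.inr (o k)) *
          (ind (Sum.elim x r p = Sum.elim y r q) - ind (f p = Sum.elim y r q))
          = ind (r (o k) = Sum.elim y r q) - ind (r (o (k+1)) = Sum.elim y r q) := by
        intro k
        rw [Finset.sum_eq_single (Sum.inr (o k))]
        · rw [ind_pos rfl, one_mul, ← hstep]; rfl
        · intro p _ hp
          rw [ind_neg hp, zero_mul]
        · simp
      simp only [this]
      rw [Finset.sum_Ico_eq_sum_range]
      have h3 := Finset.sum_range_sub' (fun k => ind (r (o (i + k)) = Sum.elim y r q)) (j - i)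
      simp only [← add_assoc] at h3
      rw [h3, Nat.add_sub_cancel' hij.le, ← hoij]
      simp

lemma cond_iff (x y : Fin a → V) (r : ρ → V) (hrv : Function.Injective (Sum.elim x r))
    (hy : ∀ j, y j ∉ Set.range (Sum.elim x r)) (hyi : Function.Injective y)
    (f : Fin a ⊕ ρ → V) (π : Equiv.Perm (Fin a)) :
    ((∀ v, ∃ k, (extf r (f ∘ Sum.inr))^[k] v ∉ Set.range r) ∧
          ∀ i, hit r (f ∘ Sum.inr) (f (Sum.inl i)) (y (π i))) ↔
    ((∀ v, ∃ k, (extf (Sum.elim x r) f)^[k] v ∈ (Set.range (Sum.elim x r))ᶜ) ∧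
      ∀ i, ∃ k, (extf (Sum.elim x r) f)^[k] (x i) = y (π i)) := by
  have hr : Function.Injective r := fun p q h => by
    have := @hrv (Sum.inr p) (Sum.inr q) h
    simpa using this
  have hxr : ∀ i q, x i ≠ r q := fun i q h => by
    have := @hrv (Sum.inl i) (Sum.inr q) h
    simp at this
  set g := extf (Sum.elim x r) f with hgdef
  set g' := extf r (f ∘ Sum.inr) with hg'def
  have hgx : ∀ i, g (x i) = f (Sum.inl i) := fun i => extf_apply hrv f (Sum.inl i)
  have hgr : ∀ q, g (r q) = f (Sum.inr q) := fun q => extf_apply hrv f (Sum.inr q)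
  have hg'r : ∀ q, g' (r q) = f (Sum.inr q) := fun q => extf_apply hr _ q
  have hg'n : ∀ v, v ∉ Set.range r → g' v = v := fun v hv => extf_of_not _ hv
  have hS : ∀ s ∈ (Set.range (Sum.elim x r))ᶜ, g s = s := fun s hs => extf_of_not f hs
  have hcases : ∀ v, v ∉ Set.range r → v ∈ (Set.range (Sum.elim x r))ᶜ ∨ ∃ i, v = x i := by
    intro v hv
    by_cases h : v ∈ Set.range (Sum.elim x r)
    · obtain ⟨i | q, rfl⟩ := h
      · exact Or.inr ⟨i, rfl⟩
      · exact absurd ⟨q, rfl⟩ hv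
    · exact Or.inl h
  have hsim : ∀ n v, ∃ k, g^[k] v = g'^[n] v := by
    intro n
    induction n with
    | zero => exact fun v => ⟨0, rfl⟩
    | succ n ih =>
      intro v
      by_cases hv : v ∈ Set.range r
      · obtain ⟨q, rfl⟩ := hv
        obtain ⟨k, hk⟩ := ih (f (Sum.inr q))
        exact ⟨k+1, by rw [Function.iterate_succ_apply, Function.iterate_succ_apply, hgr, hg'r, hk]⟩
      · refine ⟨0, ?_⟩
        rw [Function.iterate_fixed (hg'n v hv)]; rfl
  constructor
  · rintro ⟨h1, h2⟩
    have h3 : ∀ i, ∃ k, g^[k] (x i) = y (π i) := by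
      intro i
      obtain ⟨n, hn⟩ := h2 i
      obtain ⟨k, hk⟩ := hsim n (f (Sum.inl i))
      exact ⟨k+1, by rw [Function.iterate_succ_apply, hgx, hk]; exact hn⟩
    refine ⟨fun v => ?_, h3⟩
    obtain ⟨n, hn⟩ := h1 v
    obtain ⟨k, hk⟩ := hsim n v
    rcases hcases _ hn with h | ⟨i, hi⟩
    · exact ⟨k, hk ▸ h⟩
    · obtain ⟨l, hl⟩ := h3 i
      refine ⟨l + k, ?_⟩
      rw [Function.iterate_add_apply, hk, hi, hl]
      exact hy _
  · rintro ⟨h1, h2⟩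
    have h3 : ∀ k v, g^[k] v ∈ (Set.range (Sum.elim x r))ᶜ → ∃ k, g'^[k] v ∉ Set.range r := by
      intro k
      induction k with
      | zero =>
        rintro v hv
        refine ⟨0, ?_⟩
        rintro ⟨q, hq⟩
        exact hv ⟨Sum.inr q, hq⟩
      | succ k ih =>
        intro v hv
        by_cases hvr : v ∈ Set.range r
        · obtain ⟨q, rfl⟩ := hvr
          rw [Function.iterate_succ_apply, hgr] at hv
          obtain ⟨l, hl⟩ := ih _ hv
          exact ⟨l+1, by rw [Function.iterate_succ_apply, hg'r]; exact hl⟩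
        · exact ⟨0, hvr⟩
    have h4 : ∀ v, ∃ k, g'^[k] v ∉ Set.range r := fun v => by
      obtain ⟨k, hk⟩ := h1 v
      exact h3 k v hk
    refine ⟨h4, fun i => ?_⟩
    obtain ⟨n, hn⟩ := h4 (f (Sum.inl i))
    obtain ⟨k, hk⟩ := hsim n (f (Sum.inl i))
    have hk' : g^[k+1] (x i) = g'^[n] (f (Sum.inl i)) := by
      rw [Function.iterate_succ_apply, hgx, hk]
    refine ⟨n, ?_⟩
    rcases hcases _ hn with h | ⟨j, hj⟩
    · exact iter_unique hS h (hy _) ⟨k+1, hk'⟩ (h2 i)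
    · exfalso
      rw [hj] at hk'
      obtain ⟨l, hl⟩ := h2 j
      have : y (π i) = y (π j) := iter_unique hS (hy _) (hy _) (h2 i)
        ⟨l + (k+1), by rw [Function.iterate_add_apply, hk', hl]⟩
      have hij : i = j := π.injective (hyi this)
      rw [← hij] at hk'
      exact no_cycle hS h1 hk' ⟨Sum.inl i, rfl⟩

/-- All-minors matrix-tree theorem. -/
theorem all_minors (c : V → V → ℝ) (hc : ∀ k l, c k l = c l k)
    (G : SimpleGraph V) (hG : ∀ k l, ¬ G.Adj k l → c k l = 0)
    (x y : Fin a → V) (r : ρ → V) (hrv : Function.Injective (Sum.elim x r))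
    (hy : ∀ j, y j ∉ Set.range (Sum.elim x r)) (hyi : Function.Injective y) :
    (Matrix.of fun p q : Fin a ⊕ ρ => ∑ v, c (Sum.elim x r p) v *
      (ind (Sum.elim x r p = Sum.elim y r q) - ind (v = Sum.elim y r q))).det
    = (-1) ^ a * ∑ π : Equiv.Perm (Fin a), ((Equiv.Perm.sign π : ℤ) : ℝ) *
      ∑ H ∈ Finset.univ.filter (fun H : SimpleGraph V => (H ≤ G ∧ H.IsAcyclic) ∧
          (∀ v, ∃! s, s ∈ (Set.range (Sum.elim x r))ᶜ ∧ H.Reachable v s) ∧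
          ∀ i, H.Reachable (x i) (y (π i))), wt c hc H := by
  rw [det_expand]
  simp only [det_Mf x y r hrv hy, ind_congr (cond_iff x y r hrv hy hyi _ _)]
  simp only [Finset.mul_sum (s := (Finset.univ : Finset (Equiv.Perm (Fin a))))]
  rw [Finset.sum_comm]
  refine Finset.sum_congr rfl fun π _ => ?_
  have key := sum_forest c hc G hG hrv (fun g => ∀ i, ∃ k, g^[k] (x i) = y (π i))
    (fun H => ∀ i, H.Reachable (x i) (y (π i)))
    (fun g hS => forall_congr' fun i => (gr_reach_iff hS (hy _)).symm)
  trans (-1) ^ a * (((Equiv.Perm.sign π : ℤ) : ℝ) * ∑ f : Fin a ⊕ ρ → V,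
    (∏ p, c (Sum.elim x r p) (f p)) *
        ind ((∀ v, ∃ k, (extf (Sum.elim x r) f)^[k] v ∈ (Set.range (Sum.elim x r))ᶜ) ∧
        ∀ i, ∃ k, (extf (Sum.elim x r) f)^[k] (x i) = y (π i)))
  · simp only [Finset.mul_sum]
    refine Finset.sum_congr rfl fun f _ => ?_
    ring
  · congr 2
    convert key

end Det

section Final

variable (E : Network)

/-- Laplacian entries. -/
noncomputable def lap (k l : Fin E.n) : ℝ := ∑ v, E.c k v * (ind (k = l) - ind (v = l))

/-- Interior vertices. -/
abbrev Inn := {v : Fin E.n // ¬ (v : ℕ) < E.m}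

lemma lap_sum (U : Fin E.n → ℝ) (k : Fin E.n) :
    ∑ l, lap E k l * U l = ∑ v, E.c k v * (U k - U v) := by
  have h : ∀ v, ∑ l, ind (v = l) * U l = U v := by
    intro v
    rw [Finset.sum_eq_single v]
    · rw [ind_pos rfl, one_mul]
    · intro l _ hl
      rw [ind_neg hl.symm, zero_mul]
    · simp
  simp only [lap, Finset.sum_mul]
  rw [Finset.sum_comm]
  refine Finset.sum_congr rfl fun v _ => ?_
  simp only [mul_assoc, ← Finset.mul_sum, sub_mul, Finset.sum_sub_distrib, h]

lemma sum_split (F : Fin E.n → ℝ) :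
    ∑ l, F l = ∑ u : E.Bdry, F u.1 + ∑ i : Inn E, F i.1 :=
  (Fintype.sum_subtype_add_sum_subtype (fun v : Fin E.n => (v : ℕ) < E.m) F).symm

/-- Dirichlet Laplacian. -/
noncomputable def dir : Matrix (Inn E) (Inn E) ℝ := Matrix.of fun i j => lap E i.1 j.1

lemma dir_det_ne : (dir E).det ≠ 0 := by
  intro h
  rw [← Matrix.exists_mulVec_eq_zero_iff] at h
  obtain ⟨z, hz, hDz⟩ := h
  apply hz
  let U : Fin E.n → ℝ := fun v => if h : (v : ℕ) < E.m then 0 else z ⟨v, h⟩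
  have hUb : ∀ v : Fin E.n, (v : ℕ) < E.m → U v = 0 := fun v hv => dif_pos hv
  have hUi : ∀ i : Inn E, U i.1 = z i := fun i => dif_neg i.2
  have hcur : ∀ k, U k * ∑ v, E.c k v * (U k - U v) = 0 := by
    intro k
    by_cases hk : (k : ℕ) < E.m
    · rw [hUb k hk, zero_mul]
    · rw [← lap_sum, sum_split]
      have h1 : ∑ u : E.Bdry, lap E k u.1 * U u.1 = 0 :=
        Finset.sum_eq_zero fun u _ => by rw [hUb _ u.2, mul_zero]
      have h2 : ∑ i : Inn E, lap E k i.1 * U i.1 = 0 := by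
        have := congrFun hDz ⟨k, hk⟩
        simp only [hUi]
        exact this
      rw [h1, h2]; ring
  have hsum : ∑ k, ∑ v, E.c k v * (U k * (U k - U v)) = 0 := by
    refine Finset.sum_eq_zero fun k _ => ?_
    rw [← hcur k, Finset.mul_sum]
    refine Finset.sum_congr rfl fun v _ => by ring
  have hsum' : ∑ k, ∑ v, E.c k v * (U v * (U v - U k)) = 0 := by
    rw [Finset.sum_comm, ← hsum]
    refine Finset.sum_congr rfl fun k _ => Finset.sum_congr rfl fun v _ => ?_
    rw [E.c_symm]
  have hsq : ∑ k, ∑ v, E.c k v * (U k - U v)^2 = 0 := by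
    have : ∑ k, ∑ v, E.c k v * (U k - U v)^2 = ∑ k, ∑ v, E.c k v * (U k * (U k - U v))
        + ∑ k, ∑ v, E.c k v * (U v * (U v - U k)) := by
      simp only [← Finset.sum_add_distrib]
      refine Finset.sum_congr rfl fun k _ => Finset.sum_congr rfl fun v _ => by ring
    rw [this, hsum, hsum', add_zero]
  have hc0 : ∀ k l, 0 ≤ E.c k l := by
    intro k l
    by_cases h : E.graph.Adj k l
    · exact (E.c_pos k l h).le
    · rw [E.c_zero k l h]
  have hadj : ∀ k v, E.graph.Adj k v → U k = U v := by
    intro k v hkv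
    rw [Finset.sum_eq_zero_iff_of_nonneg
      (fun k _ => Finset.sum_nonneg fun v _ => mul_nonneg (hc0 k v) (sq_nonneg _))] at hsq
    have h1 := hsq k (Finset.mem_univ k)
    rw [Finset.sum_eq_zero_iff_of_nonneg (fun v _ => mul_nonneg (hc0 k v) (sq_nonneg _))] at h1
    have h2 := h1 v (Finset.mem_univ v)
    rcases mul_eq_zero.1 h2 with h3 | h3
    · exact absurd h3 (E.c_pos k v hkv).ne'
    · exact sub_eq_zero.1 (pow_eq_zero_iff (two_ne_zero)|>.1 h3)
  have hreach : ∀ k v, E.graph.Reachable k v → U k = U v := by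
    rintro k v ⟨p⟩
    induction p with
    | nil => rfl
    | cons h p ih => exact (hadj _ _ h).trans ih
  funext i
  have h0 : 0 < E.n := lt_of_lt_of_le E.m_pos E.m_le
  rw [← hUi i, hreach i.1 ⟨0, h0⟩ (E.connected.preconnected _ _)]
  exact hUb _ E.m_pos

lemma filter_univ_congr {α : Type*} {i1 i2 : Fintype α} {p q : α → Prop}
    {d1 : DecidablePred p} {d2 : DecidablePred q} (h : ∀ a, p a ↔ q a) :
    @Finset.filter α p d1 (@Finset.univ α i1) = @Finset.filter α q d2 (@Finset.univ α i2) := by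
  ext z
  simp [h]

lemma dir_det : (dir E).det =
    ∑ H ∈ Finset.univ.filter (fun H => E.IsValidForest H), E.weight H := by
  have key := all_minors E.c E.c_symm E.graph E.c_zero (a := 0) (ρ := Inn E)
    (fun i => i.elim0) (fun i => i.elim0) (fun i => i.1)
    (by
      rintro (i | p) (j | q) h
      · exact i.elim0
      · exact i.elim0
      · exact j.elim0
      · exact congrArg Sum.inr (Subtype.ext h))
    (fun i => i.elim0) (fun i => i.elim0)
  have hdet : (dir E).det = (Matrix.of fun p q : Fin 0 ⊕ Inn E =>
      ∑ v, E.c (Sum.elim (fun i : Fin 0 => i.elim0) (fun i : Inn E => i.1) p) v *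
      (ind (Sum.elim (fun i : Fin 0 => i.elim0) (fun i : Inn E => i.1) p
        = Sum.elim (fun i : Fin 0 => i.elim0) (fun i : Inn E => i.1) q)
        - ind (v = Sum.elim (fun i : Fin 0 => i.elim0) (fun i : Inn E => i.1) q))).det := by
    rw [← Matrix.det_submatrix_equiv_self (Equiv.emptySum (Fin 0) (Inn E)).symm]
    rfl
  rw [hdet]
  refine key.trans ?_
  have hS : ∀ s : Fin E.n, s ∈ (Set.range (Sum.elim (fun i : Fin 0 => i.elim0)
      (fun i : Inn E => i.1)))ᶜ ↔ (s : ℕ) < E.m := by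
    intro s
    rw [Set.mem_compl_iff, not_iff_comm]
    constructor
    · intro h
      exact ⟨Sum.inr ⟨s, h⟩, rfl⟩
    · rintro ⟨i | q, rfl⟩
      · exact i.elim0
      · exact q.2
  rw [Fintype.sum_unique]
  simp only [pow_zero, one_mul]
  rw [show (default : Equiv.Perm (Fin 0)) = 1 from rfl]
  simp only [Equiv.Perm.sign_one, Units.val_one, Int.cast_one, one_mul]
  refine Finset.sum_congr (filter_univ_congr fun H => ?_) (fun H _ => rfl)
  unfold Network.IsValidForest Network.IsSpanningForest
  simp only [hS]
  refine and_congr Iff.rfl ?_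
  constructor
  · rintro ⟨h, -⟩ comp
    induction comp using SimpleGraph.ConnectedComponent.ind with
    | _ v =>
    obtain ⟨s, ⟨hs1, hs2⟩, hu⟩ := h v
    rw [Finset.card_eq_one]
    refine ⟨s, ?_⟩
    ext t
    simp only [Finset.mem_filter, Finset.mem_univ, true_and, Finset.mem_singleton,
      SimpleGraph.ConnectedComponent.eq]
    constructor
    · rintro ⟨h1, h2⟩
      exact hu t ⟨h1, h2.symm⟩
    · rintro rfl
      exact ⟨hs1, hs2.symm⟩
  · intro h
    refine ⟨fun v => ?_, fun i => i.elim0⟩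
    obtain ⟨s, hs⟩ := Finset.card_eq_one.1 (h (H.connectedComponentMk v))
    have hs' : ∀ t : Fin E.n, ((t : ℕ) < E.m ∧ H.Reachable t v) ↔ t = s := by
      intro t
      have := congrArg (t ∈ ·) hs
      simpa only [Finset.mem_filter, Finset.mem_univ, true_and, Finset.mem_singleton,
        SimpleGraph.ConnectedComponent.eq, eq_iff_iff] using this
    have h1 := (hs' s).2 rfl
    refine ⟨s, ⟨h1.1, h1.2.symm⟩, ?_⟩
    rintro t ⟨ht1, ht2⟩
    exact (hs' t).1 ⟨ht1, ht2.symm⟩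

lemma response_entry (C : Matrix E.Bdry E.Bdry ℝ) (hC : E.IsResponse C) [Invertible (dir E)]
    (v u : E.Bdry) :
    C v u = lap E v.1 u.1 - ∑ i : Inn E, lap E v.1 i.1 *
      ∑ j : Inn E, (⅟(dir E)) i j * lap E j.1 u.1 := by
  let X : Inn E → ℝ := fun i => ∑ j : Inn E, (⅟(dir E)) i j * lap E j.1 u.1
  let U : Fin E.n → ℝ := fun k => if h : (k : ℕ) < E.m then ind (k = u.1) else - X ⟨k, h⟩
  have hUb : ∀ w : E.Bdry, U w.1 = ind (w = u) := fun w =>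
    (dif_pos w.2).trans (ind_congr Subtype.ext_iff.symm)
  have hUi : ∀ i : Inn E, U i.1 = - X i := fun i => dif_neg i.2
  have hsingle : ∀ F : E.Bdry → ℝ, ∑ w : E.Bdry, F w * ind (w = u) = F u := by
    intro F
    rw [Finset.sum_eq_single u]
    · rw [ind_pos rfl, mul_one]
    · intro l _ hl
      rw [ind_neg hl, mul_zero]
    · simp
  have hcur : ∀ k, ∑ l, E.c k l * (U k - U l) = lap E k u.1 - ∑ i : Inn E, lap E k i.1 * X i := by
    intro k
    rw [← lap_sum, sum_split]
    simp only [hUb, hUi]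
    rw [hsingle (fun w => lap E k w.1)]
    simp only [mul_neg, Finset.sum_neg_distrib]
    ring
  have h := hC (fun w => ind (w = u)) U (fun k l => E.c k l * (U k - U l)) (fun _ _ => rfl)
    (by
      intro k hk
      rw [hcur]
      have h1 : (dir E) * (⅟(dir E) * (Matrix.of fun (j : Inn E) (_ : Unit) => lap E j.1 u.1))
          = Matrix.of fun (j : Inn E) (_ : Unit) => lap E j.1 u.1 :=
        Matrix.mul_invOf_cancel_left _ _
      have h2 := congrFun (congrFun h1 ⟨k, not_lt.2 hk⟩) ()
      have h3 : ∑ i : Inn E, lap E k i.1 * X i = lap E k u.1 := h2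
      rw [h3, sub_self])
    hUb v
  rw [hsingle (fun w => C v w), hcur] at h
  exact h.symm

lemma forest_cond {V : Type*} [Fintype V] (H : SimpleGraph V) (a b : ℕ) (x y : Fin a → V)
    (w : Fin b → V) (hinj : Function.Injective (Sum.elim y w)) (S : Set V)
    (hS : ∀ s, s ∈ S ↔ s ∈ Set.range (Sum.elim y w)) (π : Equiv.Perm (Fin a)) :
    ((∀ v, ∃! s, s ∈ S ∧ H.Reachable v s) ∧ ∀ i, H.Reachable (x i) (y (π i))) ↔
    (Nat.card H.ConnectedComponent = a + b ∧ (∀ t, H.Reachable (x t) (y (π t))) ∧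
      Function.Injective (Sum.elim (fun t : Fin a => H.connectedComponentMk (x t))
              (fun s : Fin b => H.connectedComponentMk (w s)))) := by
  rw [and_left_comm, and_comm]
  refine and_congr_right fun hxy => ?_
  let F' : Fin a ⊕ Fin b → V := Sum.elim (fun i => y (π i)) w
  have hF : Sum.elim (fun t : Fin a => H.connectedComponentMk (x t))
      (fun s : Fin b => H.connectedComponentMk (w s)) = fun p => H.connectedComponentMk (F' p) := by
    funext p
    rcases p with i | j
    · exact SimpleGraph.ConnectedComponent.eq.2 (hxy i)
    · rfl
  have hF'eq : F' = Sum.elim y w ∘ Sum.map π id := by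
    funext p
    rcases p with i | j <;> rfl
  have hF'inj : Function.Injective F' := by
    rw [hF'eq]
    exact hinj.comp (Sum.map_injective.2 ⟨π.injective, Function.injective_id⟩)
  have hF'S : ∀ s, s ∈ S ↔ ∃ p, F' p = s := by
    intro s
    rw [hS]
    constructor
    · rintro ⟨i | j, rfl⟩
      · exact ⟨Sum.inl (π.symm i), by simp [F']⟩
      · exact ⟨Sum.inr j, rfl⟩
    · rintro ⟨p, rfl⟩
      rw [hF'eq]
      exact ⟨_, rfl⟩
  rw [hF]
  constructor
  · intro h
    have hi : Function.Injective (fun p => H.connectedComponentMk (F' p)) := by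
      intro p q hpq
      have hr := SimpleGraph.ConnectedComponent.eq.1 hpq
      apply hF'inj
      exact (h (F' p)).unique ⟨(hF'S _).2 ⟨p, rfl⟩, SimpleGraph.Reachable.refl _⟩
        ⟨(hF'S _).2 ⟨q, rfl⟩, hr⟩
    refine ⟨?_, hi⟩
    have hb : Function.Bijective (fun p => H.connectedComponentMk (F' p)) := by
      refine ⟨hi, fun comp => ?_⟩
      induction comp using SimpleGraph.ConnectedComponent.ind with
      | _ v =>
      obtain ⟨s, ⟨hs, hr⟩, -⟩ := h v
      obtain ⟨p, rfl⟩ := (hF'S s).1 hs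
      exact ⟨p, SimpleGraph.ConnectedComponent.eq.2 hr.symm⟩
    rw [← Nat.card_eq_of_bijective _ hb]
    simp
  · rintro ⟨hcard, hi⟩ v
    have hb : Function.Bijective (fun p => H.connectedComponentMk (F' p)) := by
      rw [Fintype.bijective_iff_injective_and_card]
      refine ⟨hi, ?_⟩
      rw [← Nat.card_eq_fintype_card, ← Nat.card_eq_fintype_card, hcard]
      simp
    obtain ⟨p, hp⟩ := hb.2 (H.connectedComponentMk v)
    refine ⟨F' p, ⟨(hF'S _).2 ⟨p, rfl⟩, (SimpleGraph.ConnectedComponent.eq.1 hp).symm⟩, ?_⟩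
    rintro t ⟨ht, hr⟩
    obtain ⟨q, rfl⟩ := (hF'S t).1 ht
    congr 1
    apply hi
    exact (SimpleGraph.ConnectedComponent.eq.2 hr.symm).trans hp.symm

end Final

/-- **Kenyon–Wilson's all-minors matrix-tree theorem** (Theorem 2.5, with corrected
overall sign).  Let the boundary vertices be decomposed into disjoint subsets
`X = {x 0, …, x (a-1)}`, `Y = {y 0, …, y (a-1)}`, `Z`, `W = {w 0, …, w (b-1)}`.  Then
`det C_{X,Z}^{Y,Z} · Σ_H w(H) = (−1)^a Σ_{π} sgn(π) ·
w(x_1 y_{π(1)} | … | x_a y_{π(a)} | w_1 | … | w_b)`, where `H` ranges over all valid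
forests, and the inner sum for a permutation `π` is over all spanning forests with exactly
`a + b` components such that `x t` and `y (π t)` lie in the `t`-th component and each
`w s` lies in its own separate component. -/
theorem kenyon_wilson (E : Network) (C : Matrix E.Bdry E.Bdry ℝ) (hC : E.IsResponse C)
    (a b : ℕ) (x y : Fin a → E.Bdry) (w : Fin b → E.Bdry) (Z : Finset E.Bdry)
    (hx : Function.Injective x) (hy : Function.Injective y) (hw : Function.Injective w)
    (hxy : Disjoint (Finset.univ.image x) (Finset.univ.image y))
    (hxz : Disjoint (Finset.univ.image x) Z)
    (hxw : Disjoint (Finset.univ.image x) (Finset.univ.image w))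
    (hyz : Disjoint (Finset.univ.image y) Z)
    (hyw : Disjoint (Finset.univ.image y) (Finset.univ.image w))
    (hzw : Disjoint Z (Finset.univ.image w))
    (hcover : Finset.univ.image x ∪ Finset.univ.image y ∪ Z ∪ Finset.univ.image w
      = Finset.univ) :
    (Matrix.fromBlocks
        (Matrix.of fun i j : Fin a => C (x i) (y j))
        (Matrix.of fun (i : Fin a) (z : {z // z ∈ Z}) => C (x i) z.1)
        (Matrix.of fun (z : {z // z ∈ Z}) (j : Fin a) => C z.1 (y j))
        (Matrix.of fun z z' : {z // z ∈ Z} => C z.1 z'.1)).det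
      * (∑ H ∈ Finset.univ.filter (fun H => E.IsValidForest H), E.weight H)
    = (-1 : ℝ) ^ a * ∑ π : Equiv.Perm (Fin a), ((Equiv.Perm.sign π : ℤ) : ℝ) *
        ∑ H ∈ Finset.univ.filter (fun H => E.IsSpanningForest H ∧
            Nat.card H.ConnectedComponent = a + b ∧
            (∀ t, H.Reachable (x t).1 (y (π t)).1) ∧
            Function.Injective (Sum.elim
              (fun t : Fin a => H.connectedComponentMk (x t).1)
              (fun s : Fin b => H.connectedComponentMk (w s).1))),
          E.weight H := by
  have hdisj : ∀ {A B : Finset E.Bdry}, Disjoint A B → ∀ {u}, u ∈ A → u ∈ B → False :=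
    fun h _ h1 h2 => (Finset.disjoint_left.1 h) h1 h2
  have hxm : ∀ i, x i ∈ Finset.univ.image x := fun i => Finset.mem_image_of_mem _ (Finset.mem_univ i)
  have hym : ∀ i, y i ∈ Finset.univ.image y := fun i => Finset.mem_image_of_mem _ (Finset.mem_univ i)
  have hwm : ∀ i, w i ∈ Finset.univ.image w := fun i => Finset.mem_image_of_mem _ (Finset.mem_univ i)
  have hbi : ∀ (u : E.Bdry) (i : Inn E), u.1 = i.1 → False := fun u i h => i.2 (h ▸ u.2)
  let xx : Fin a → Fin E.n := fun i => (x i).1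
  let yy : Fin a → Fin E.n := fun i => (y i).1
  let ww : Fin b → Fin E.n := fun i => (w i).1
  let r : {z // z ∈ Z} ⊕ Inn E → Fin E.n := Sum.elim (fun z => z.1.1) (fun i => i.1)
  have hrv : Function.Injective (Sum.elim xx r) := by
    rintro (i | z | i) (j | z' | j) h
    · exact congrArg _ (hx (Subtype.ext h))
    · exact (hdisj hxz (hxm i) ((Subtype.ext h : x i = z'.1) ▸ z'.2)).elim
    · exact (hbi (x i) j h).elim
    · exact (hdisj hxz (hxm j) ((Subtype.ext h : z.1 = x j) ▸ z.2)).elim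
    · exact congrArg _ (congrArg _ (Subtype.ext (Subtype.ext h)))
    · exact (hbi z.1 j h).elim
    · exact (hbi (x j) i h.symm).elim
    · exact (hbi z'.1 i h.symm).elim
    · exact congrArg _ (congrArg _ (Subtype.ext h))
  have hyS : ∀ j, yy j ∉ Set.range (Sum.elim xx r) := by
    rintro j ⟨i | z | i, h⟩
    · exact hdisj hxy (hxm i) ((Subtype.ext h : x i = y j) ▸ hym j)
    · exact hdisj hyz (hym j) ((Subtype.ext h : z.1 = y j) ▸ z.2)
    · exact hbi (y j) i h.symm
  have hwS : ∀ j, ww j ∉ Set.range (Sum.elim xx r) := by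
    rintro j ⟨i | z | i, h⟩
    · exact hdisj hxw (hxm i) ((Subtype.ext h : x i = w j) ▸ hwm j)
    · exact hdisj hzw z.2 ((Subtype.ext h : z.1 = w j) ▸ hwm j)
    · exact hbi (w j) i h.symm
  have hyyinj : Function.Injective yy := fun i j h => hy (Subtype.ext h)
  have hinj : Function.Injective (Sum.elim yy ww) := by
    rintro (i | i) (j | j) h
    · exact congrArg _ (hyyinj h)
    · exact (hdisj hyw (hym i) ((Subtype.ext h : y i = w j) ▸ hwm j)).elim
    · exact (hdisj hyw (hym j) ((Subtype.ext h : w i = y j) ▸ hwm i)).elim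
    · exact congrArg _ (hw (Subtype.ext h))
  have hS : ∀ s, s ∈ (Set.range (Sum.elim xx r))ᶜ ↔ s ∈ Set.range (Sum.elim yy ww) := by
    intro s
    constructor
    · intro hs
      have hsm : (s : ℕ) < E.m := by
        by_contra h
        exact hs ⟨Sum.inr (Sum.inr ⟨s, h⟩), rfl⟩
      have hmem : (⟨s, hsm⟩ : E.Bdry) ∈ Finset.univ.image x ∪ Finset.univ.image y ∪ Z ∪
          Finset.univ.image w := by rw [hcover]; exact Finset.mem_univ _
      simp only [Finset.mem_union, Finset.mem_image, Finset.mem_univ, true_and] at hmem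
      rcases hmem with ((⟨i, hi⟩ | ⟨i, hi⟩) | hz) | ⟨i, hi⟩
      · exact (hs ⟨Sum.inl i, congrArg Subtype.val hi⟩).elim
      · exact ⟨Sum.inl i, congrArg Subtype.val hi⟩
      · exact (hs ⟨Sum.inr (Sum.inl ⟨_, hz⟩), rfl⟩).elim
      · exact ⟨Sum.inr i, congrArg Subtype.val hi⟩
    · rintro ⟨i | i, rfl⟩
      · exact hyS i
      · exact hwS i
  have key := all_minors E.c E.c_symm E.graph E.c_zero xx yy r hrv hyS hyyinj
  let inv : Invertible (dir E) := Matrix.invertibleOfIsUnitDet _ (isUnit_iff_ne_zero.2 (dir_det_ne E))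
  let p1 : Fin a ⊕ {z // z ∈ Z} → E.Bdry := Sum.elim x (fun z => z.1)
  let q1 : Fin a ⊕ {z // z ∈ Z} → E.Bdry := Sum.elim y (fun z => z.1)
  have hblock : Matrix.fromBlocks
        (Matrix.of fun i j : Fin a => C (x i) (y j))
        (Matrix.of fun (i : Fin a) (z : {z // z ∈ Z}) => C (x i) z.1)
        (Matrix.of fun (z : {z // z ∈ Z}) (j : Fin a) => C z.1 (y j))
        (Matrix.of fun z z' : {z // z ∈ Z} => C z.1 z'.1)
      = (Matrix.of fun p q => lap E (p1 p).1 (q1 q).1) -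
        (Matrix.of fun p (i : Inn E) => lap E (p1 p).1 i.1) * ⅟(dir E) *
        (Matrix.of fun (i : Inn E) q => lap E i.1 (q1 q).1) := by
    rw [Matrix.mul_assoc]
    have h : ∀ p q, C (p1 p) (q1 q) = ((Matrix.of fun p q => lap E (p1 p).1 (q1 q).1) -
        (Matrix.of fun p (i : Inn E) => lap E (p1 p).1 i.1) * (⅟(dir E) *
        (Matrix.of fun (i : Inn E) q => lap E i.1 (q1 q).1))) p q := fun p q =>
      response_entry E C hC (p1 p) (q1 q)
    ext p q
    rw [← h]
    rcases p with i | z <;> rcases q with j | z' <;> rfl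
  have hdet : (Matrix.of fun p q : Fin a ⊕ ({z // z ∈ Z} ⊕ Inn E) => ∑ v, E.c (Sum.elim xx r p) v *
      (ind (Sum.elim xx r p = Sum.elim yy r q) - ind (v = Sum.elim yy r q))).det
      = (Matrix.fromBlocks (Matrix.of fun p q => lap E (p1 p).1 (q1 q).1)
        (Matrix.of fun p (i : Inn E) => lap E (p1 p).1 i.1)
        (Matrix.of fun (i : Inn E) q => lap E i.1 (q1 q).1) (dir E)).det := by
    rw [← Matrix.det_submatrix_equiv_self (Equiv.sumAssoc (Fin a) {z // z ∈ Z} (Inn E))]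
    congr 1
    ext p q
    rcases p with (i | z) | i <;> rcases q with (j | z') | j <;> rfl
  rw [hblock, ← dir_det, mul_comm, ← Matrix.det_fromBlocks₂₂]
  refine Eq.trans ?_ (key.trans ?_)
  · rw [hdet]
  · congr 1
    refine Finset.sum_congr rfl fun π _ => ?_
    congr 1
    refine Finset.sum_congr ?_ (fun H _ => rfl)
    ext H
    simp only [Finset.mem_filter, Finset.mem_univ, true_and]
    exact and_congr Iff.rfl (forest_cond H a b xx yy ww hinj _ hS π)

end ElecNet
end

section
/- Consider an electrical circuit with exactly two boundary vertices 1 and 2 and prescribed voltages U_1 = 1 and U_2 = 0. Then w(1|2) > 0, and for every vertex k ≠ 2 the voltage satisfies U_k · w(1|2) = w(1k|2), where w(1k|2) denotes the sum of the weights of all spanning forests with exactly two components such that vertices 1 and k lie in one component and vertex 2 lies in the other (for k = 1 this is w(1|2) itself), and w(1|2) denotes the sum of the weights of all spanning forests with exactly two components such that 1 and 2 lie in different components. -/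
open Finset BigOperators
open scoped Classical

namespace ElecNet

section GraphLemmas

variable {V : Type*}

/-- In a tree, every `k ≠ x` has a unique neighbour towards `x`. -/
lemma exists_unique_towards (T : SimpleGraph V) (hT : T.IsTree) (k x : V) (hkx : k ≠ x) :
    ∃! l, T.Adj k l ∧ (T.deleteEdges {s(k, l)}).Reachable l x := by
  obtain ⟨q, hq, -⟩ := hT.existsUnique_path k x
  refine existsUnique_of_exists_of_unique ?_ ?_
  · cases q with
    | nil => exact absurd rfl hkx
    | @cons _ v _ h q =>
      rw [SimpleGraph.Walk.cons_isPath_iff] at hq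
      refine ⟨v, h, ?_⟩
      rw [SimpleGraph.reachable_deleteEdges_iff_exists_walk]
      exact ⟨q, fun hm => hq.2 (q.fst_mem_support_of_mem_edges hm)⟩
  · have key : ∀ l, (T.Adj k l ∧ (T.deleteEdges {s(k, l)}).Reachable l x) → l = q.snd := by
      rintro l ⟨hl, hr⟩
      have hb := SimpleGraph.isAcyclic_iff_forall_adj_isBridge.1 hT.isAcyclic hl
      rw [SimpleGraph.isBridge_iff] at hb
      have hn : ¬ (T.deleteEdges {s(k, l)}).Reachable k x := fun h => hb (h.trans hr.symm)
      have hm := q.mem_edges_of_not_reachable_deleteEdges hn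
      exact hT.isAcyclic.eq_snd_of_adj_start hq hl (q.snd_mem_support_of_mem_edges hm)
    intro a b ha hb
    rw [key a ha, key b hb]

lemma card_eq_two_iff [Finite V] (H : SimpleGraph V) (u v : V) (h : ¬ H.Reachable u v) :
    Nat.card H.ConnectedComponent = 2 ↔ ∀ x, H.Reachable x u ∨ H.Reachable x v := by
  have hne : H.connectedComponentMk u ≠ H.connectedComponentMk v := fun e =>
    h (SimpleGraph.ConnectedComponent.exact e)
  rw [Nat.card_eq_two_iff' (H.connectedComponentMk u)]
  constructor
  · rintro ⟨c, hc, hu⟩ x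
    by_cases hx : H.connectedComponentMk x = H.connectedComponentMk u
    · exact Or.inl (SimpleGraph.ConnectedComponent.exact hx)
    · right
      apply SimpleGraph.ConnectedComponent.exact
      rw [hu _ hx]
      exact (hu _ hne.symm).symm
  · intro hx
    refine ⟨H.connectedComponentMk v, hne.symm, ?_⟩
    intro c hc
    induction c using SimpleGraph.ConnectedComponent.ind with
    | h x =>
      rcases hx x with h | h
      · exact absurd (SimpleGraph.ConnectedComponent.sound h) hc
      · exact SimpleGraph.ConnectedComponent.sound h

lemma tree_delete (T : SimpleGraph V) (hT : T.IsTree) (k l : V) (hl : T.Adj k l) :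
    (T.deleteEdges {s(k, l)}).IsAcyclic ∧ ¬ (T.deleteEdges {s(k, l)}).Reachable k l ∧
      ∀ x, (T.deleteEdges {s(k, l)}).Reachable x k ∨ (T.deleteEdges {s(k, l)}).Reachable x l := by
  refine ⟨hT.isAcyclic.anti (SimpleGraph.deleteEdges_le _),
    SimpleGraph.isBridge_iff.1 (SimpleGraph.isAcyclic_iff_forall_adj_isBridge.1 hT.isAcyclic hl),
    fun x => ?_⟩
  obtain ⟨p⟩ := hT.connected.preconnected x k
  induction p with
  | nil => left; rfl
  | @cons a b c hab q ih =>
    by_cases he : s(a, b) = s(c, l)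
    · rw [Sym2.eq_iff] at he
      rcases he with ⟨rfl, -⟩ | ⟨rfl, -⟩
      · left; rfl
      · right; rfl
    · have : (T.deleteEdges {s(c, l)}).Adj a b := by
        simp only [SimpleGraph.deleteEdges_adj, Set.mem_singleton_iff]
        exact ⟨hab, he⟩
      exact (ih hl).imp this.reachable.trans this.reachable.trans

lemma tree_add [Nonempty V] (H : SimpleGraph V) (hH : H.IsAcyclic) (k l : V)
    (hkl : ¬ H.Reachable k l)
    (hx : ∀ x, H.Reachable x k ∨ H.Reachable x l) : (H ⊔ SimpleGraph.edge k l).IsTree := by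
  have hle : H ≤ H ⊔ SimpleGraph.edge k l := le_sup_left
  have hne : k ≠ l := by rintro rfl; exact hkl (by rfl)
  have hadj : (H ⊔ SimpleGraph.edge k l).Adj k l := by
    simp [SimpleGraph.edge_adj, hne]
  have hk : ∀ x, (H ⊔ SimpleGraph.edge k l).Reachable x k := fun x =>
    (hx x).elim (fun h => h.mono hle) (fun h => (h.mono hle).trans hadj.symm.reachable)
  exact { connected := { preconnected := fun x y => (hk x).trans (hk y).symm }
          isAcyclic := .sup_edge_of_not_reachable hkl hH }

lemma delete_add (H : SimpleGraph V) (k l : V) (hkl : ¬ H.Reachable k l) :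
    (H ⊔ SimpleGraph.edge k l).deleteEdges {s(k, l)} = H := by
  ext a b
  have : H.Adj a b → s(a, b) ≠ s(k, l) := by
    intro h e
    rw [Sym2.eq_iff] at e
    rcases e with ⟨rfl, rfl⟩ | ⟨rfl, rfl⟩
    · exact hkl h.reachable
    · exact hkl h.symm.reachable
  rw [Ne, Sym2.eq_iff] at this
  simp only [SimpleGraph.deleteEdges_adj, SimpleGraph.sup_adj, SimpleGraph.edge_adj,
    Set.mem_singleton_iff, Sym2.eq_iff]
  tauto

lemma add_delete (T : SimpleGraph V) (k l : V) (hkl : T.Adj k l) :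
    (T.deleteEdges {s(k, l)}) ⊔ SimpleGraph.edge k l = T := by
  ext a b
  have : (a = k ∧ b = l ∨ a = l ∧ b = k) → T.Adj a b := by
    rintro (⟨rfl, rfl⟩ | ⟨rfl, rfl⟩)
    · exact hkl
    · exact hkl.symm
  have h2 : T.Adj a b → a ≠ b := fun h => h.ne
  simp only [SimpleGraph.deleteEdges_adj, SimpleGraph.sup_adj, SimpleGraph.edge_adj,
    Set.mem_singleton_iff, Sym2.eq_iff] at *
  tauto

end GraphLemmas

namespace Network

variable (E : Network)

lemma weight_pos (H : SimpleGraph (Fin E.n)) (hH : H ≤ E.graph) : 0 < E.weight H := by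
  unfold weight
  apply Finset.prod_pos
  intro e he
  induction e using Sym2.ind with
  | h x y =>
    simp only [Set.Finite.mem_toFinset, SimpleGraph.mem_edgeSet] at he
    exact E.c_pos _ _ (hH he)

lemma weight_delete (T : SimpleGraph (Fin E.n)) (k l : Fin E.n) (h : T.Adj k l) :
    E.c k l * E.weight (T.deleteEdges {s(k, l)}) = E.weight T := by
  unfold weight
  have hm : s(k, l) ∈ (Set.toFinite T.edgeSet).toFinset := by simpa using h
  rw [← Finset.mul_prod_erase _ _ hm]
  congr 1
  apply Finset.prod_congr _ (fun _ _ => rfl)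
  ext e
  simp [SimpleGraph.edgeSet_deleteEdges, and_comm]

/-- The bitrees separating `a` and `b`. -/
noncomputable def bitrees (a b : Fin E.n) : Finset (SimpleGraph (Fin E.n)) :=
  Finset.univ.filter (fun H => E.IsSpanningForest H ∧
            Nat.card H.ConnectedComponent = 2 ∧ ¬ H.Reachable a b)

lemma mem_bitrees (a b : Fin E.n) (H : SimpleGraph (Fin E.n)) : H ∈ E.bitrees a b ↔
    (H ≤ E.graph ∧ H.IsAcyclic) ∧ Nat.card H.ConnectedComponent = 2 ∧ ¬ H.Reachable a b := by
  rw [bitrees, Finset.mem_filter, IsSpanningForest]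
  exact ⟨fun h => h.2, fun h => ⟨Finset.mem_univ _, h⟩⟩

/-- Indicator of reachability. -/
noncomputable def ind (H : SimpleGraph (Fin E.n)) (x y : Fin E.n) : ℝ :=
  if H.Reachable x y then 1 else 0

/-- The sum over bitrees with `k` on the side of `a`. -/
noncomputable def vv (a b k : Fin E.n) : ℝ := ∑ H ∈ E.bitrees a b, E.weight H * E.ind H k a

/-- Spanning trees. -/
noncomputable def trees : Finset (SimpleGraph (Fin E.n)) :=
  Finset.univ.filter (fun T => T ≤ E.graph ∧ T.IsTree)

lemma flow_edge (a b k l : Fin E.n) (hkl : E.graph.Adj k l) :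
    E.c k l * (E.vv a b k - E.vv a b l) =
      ∑ T ∈ E.trees, if T.Adj k l then
        E.weight T * (E.ind (T.deleteEdges {s(k, l)}) l b - E.ind (T.deleteEdges {s(k, l)}) l a)
        else 0 := by
  have : Nonempty (Fin E.n) := ⟨a⟩
  have h1 : E.c k l * (E.vv a b k - E.vv a b l) =
      ∑ H ∈ (E.bitrees a b).filter (fun H => ¬ H.Reachable k l),
        E.c k l * E.weight H * (E.ind H k a - E.ind H l a) := by
    rw [Finset.sum_filter, vv, vv, ← Finset.sum_sub_distrib, Finset.mul_sum]
    refine Finset.sum_congr rfl fun H _ => ?_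
    split_ifs with h
    · have : H.Reachable k a ↔ H.Reachable l a := ⟨h.symm.trans, h.trans⟩
      simp [ind, this]
    · ring
  have h2 : (∑ T ∈ E.trees, if T.Adj k l then
        E.weight T * (E.ind (T.deleteEdges {s(k, l)}) l b - E.ind (T.deleteEdges {s(k, l)}) l a)
        else 0) =
      ∑ T ∈ E.trees.filter (fun T => T.Adj k l ∧ ¬ (T.deleteEdges {s(k, l)}).Reachable a b),
        E.weight T * (E.ind (T.deleteEdges {s(k, l)}) k a
          - E.ind (T.deleteEdges {s(k, l)}) l a) := by
    rw [Finset.sum_filter]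
    refine Finset.sum_congr rfl fun T hT => ?_
    simp only [trees, Finset.mem_filter, Finset.mem_univ, true_and] at hT
    beta_reduce
    by_cases hadj : T.Adj k l
    · obtain ⟨-, hn, hx⟩ := tree_delete T hT.2 k l hadj
      rw [if_pos hadj]
      by_cases hab : (T.deleteEdges {s(k, l)}).Reachable a b
      · rw [if_neg (fun h => h.2 hab)]
        generalize T.deleteEdges {s(k, l)} = H at hn hx hab ⊢
        have : H.Reachable l a ↔ H.Reachable l b := ⟨fun h => h.trans hab, fun h => h.trans hab.symm⟩
        simp [ind, this]
      · rw [if_pos ⟨hadj, hab⟩]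
        generalize T.deleteEdges {s(k, l)} = H at hn hx hab ⊢
        have : H.Reachable l b ↔ H.Reachable k a := by
          constructor
          · intro h
            rcases hx a with h' | h'
            · exact h'.symm
            · exact absurd (h'.trans h) hab
          · intro h
            rcases hx b with h' | h'
            · exact absurd (h'.trans h).symm hab
            · exact h'.symm
        simp [ind, this]
    · simp [hadj]
  rw [h1, h2]
  refine Finset.sum_bij' (fun H _ => H ⊔ SimpleGraph.edge k l)
    (fun T _ => T.deleteEdges {s(k, l)}) ?_ ?_ ?_ ?_ ?_
  · intro H hH
    rw [Finset.mem_filter, mem_bitrees] at hH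
    obtain ⟨⟨⟨hle, hac⟩, hc, hab⟩, hn⟩ := hH
    simp only [trees, Finset.mem_filter, Finset.mem_univ, true_and]
    rw [delete_add H k l hn]
    refine ⟨⟨sup_le hle ?_, tree_add H hac k l hn ((card_eq_two_iff H k l hn).1 hc)⟩, ?_, hab⟩
    · rw [SimpleGraph.edge_le_iff]; exact Or.inr hkl
    · simp [SimpleGraph.edge_adj, hkl.ne]
  · intro T hT
    simp only [trees, Finset.mem_filter, Finset.mem_univ, true_and] at hT
    obtain ⟨⟨hle, ht⟩, hadj, hab⟩ := hT
    obtain ⟨hac, hn, hx⟩ := tree_delete T ht k l hadj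
    rw [Finset.mem_filter, mem_bitrees]
    exact ⟨⟨⟨(SimpleGraph.deleteEdges_le _).trans hle, hac⟩,
      (card_eq_two_iff _ k l hn).2 hx, hab⟩, hn⟩
  · intro H hH
    exact delete_add H k l (Finset.mem_filter.1 hH).2
  · intro T hT
    exact add_delete T k l (Finset.mem_filter.1 hT).2.1
  · intro H hH
    have hn := (Finset.mem_filter.1 hH).2
    have := E.weight_delete (H ⊔ SimpleGraph.edge k l) k l (by simp [SimpleGraph.edge_adj, hkl.ne])
    rw [delete_add H k l hn] at this
    simp only [delete_add H k l hn]
    rw [this]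

lemma sum_towards (T : SimpleGraph (Fin E.n)) (hT : T.IsTree) (k x : Fin E.n) (hkx : k ≠ x) :
    (∑ l, if T.Adj k l then E.ind (T.deleteEdges {s(k, l)}) l x else 0) = 1 := by
  obtain ⟨l₀, h0, hu⟩ := exists_unique_towards T hT k x hkx
  rw [Finset.sum_eq_single l₀]
  · simp [h0.1, ind, h0.2]
  · intro l _ hl
    by_cases hadj : T.Adj k l
    · have : ¬ (T.deleteEdges {s(k, l)}).Reachable l x := fun h => hl (hu l ⟨hadj, h⟩)
      simp [ind, this]
    · simp [hadj]
  · simp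

lemma vv_harmonic (a b k : Fin E.n) (hka : k ≠ a) (hkb : k ≠ b) :
    ∑ l, E.c k l * (E.vv a b k - E.vv a b l) = 0 := by
  have h : ∀ l, E.c k l * (E.vv a b k - E.vv a b l) =
      ∑ T ∈ E.trees, E.weight T * ((if T.Adj k l then E.ind (T.deleteEdges {s(k, l)}) l b else 0)
        - (if T.Adj k l then E.ind (T.deleteEdges {s(k, l)}) l a else 0)) := by
    intro l
    by_cases hkl : E.graph.Adj k l
    · rw [flow_edge E a b k l hkl]
      refine Finset.sum_congr rfl fun T _ => ?_
      split_ifs <;> simp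
    · rw [E.c_zero k l hkl, zero_mul]
      symm
      apply Finset.sum_eq_zero
      intro T hT
      have : ¬ T.Adj k l := fun h => hkl ((Finset.mem_filter.1 hT).2.1 h)
      simp [this]
  simp_rw [h]
  rw [Finset.sum_comm]
  apply Finset.sum_eq_zero
  intro T hT
  have ht := (Finset.mem_filter.1 hT).2.2
  rw [← Finset.mul_sum, Finset.sum_sub_distrib, sum_towards E T ht k b hkb,
    sum_towards E T ht k a hka]
  simp

lemma bitrees_sum_pos (a b : Fin E.n) (hab : a ≠ b) : 0 < ∑ H ∈ E.bitrees a b, E.weight H := by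
  apply Finset.sum_pos
  · intro H hH
    exact E.weight_pos H (Finset.mem_filter.1 hH).2.1.1
  · obtain ⟨T, hle, hT⟩ := E.connected.exists_isTree_le
    obtain ⟨l, ⟨hl, hr⟩, -⟩ := exists_unique_towards T hT a b hab
    obtain ⟨hac, hn, hx⟩ := tree_delete T hT a l hl
    refine ⟨T.deleteEdges {s(a, l)}, ?_⟩
    rw [mem_bitrees]
    exact ⟨⟨(SimpleGraph.deleteEdges_le _).trans hle, hac⟩,
      (card_eq_two_iff _ a l hn).2 hx, fun h => hn (h.trans hr.symm)⟩

/-- A function harmonic off its zero set vanishes. -/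
lemma eq_zero_of_harmonic (D : Fin E.n → ℝ) (b : Fin E.n) (hb : D b = 0)
    (h : ∀ k, D k = 0 ∨ ∑ l, E.c k l * (D k - D l) = 0) (k : Fin E.n) : D k = 0 := by
  have h1 : ∑ k, ∑ l, E.c k l * (D k - D l) * D k = 0 := by
    apply Finset.sum_eq_zero
    intro k _
    rw [← Finset.sum_mul]
    rcases h k with h | h <;> simp [h]
  have h2 : ∑ k, ∑ l, E.c k l * (D k - D l) * D l = 
      - ∑ k, ∑ l, E.c k l * (D k - D l) * D k := by
    rw [Finset.sum_comm, ← Finset.sum_neg_distrib]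
    refine Finset.sum_congr rfl fun k _ => ?_
    rw [← Finset.sum_neg_distrib]
    refine Finset.sum_congr rfl fun l _ => ?_
    rw [E.c_symm l k]; ring
  have h3 : ∑ k, ∑ l, E.c k l * (D k - D l) ^ 2 = 0 := by
    have : ∑ k, ∑ l, E.c k l * (D k - D l) ^ 2 =
      ∑ k, ∑ l, E.c k l * (D k - D l) * D k - ∑ k, ∑ l, E.c k l * (D k - D l) * D l := by
      simp_rw [← Finset.sum_sub_distrib]
      refine Finset.sum_congr rfl fun k _ => Finset.sum_congr rfl fun l _ => ?_
      ring
    rw [this, h2, h1]; simp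
  have hc : ∀ k l, 0 ≤ E.c k l := fun k l => by
    by_cases hkl : E.graph.Adj k l
    · exact (E.c_pos k l hkl).le
    · rw [E.c_zero k l hkl]
  have hnn : ∀ k l, 0 ≤ E.c k l * (D k - D l) ^ 2 := fun k l => mul_nonneg (hc k l) (sq_nonneg _)
  have h4 : ∀ k l, E.graph.Adj k l → D k = D l := by
    intro k l hkl
    have h5 := (Finset.sum_eq_zero_iff_of_nonneg
      (fun k _ => Finset.sum_nonneg fun l _ => hnn k l)).1 h3 k (Finset.mem_univ _)
    have h6 := (Finset.sum_eq_zero_iff_of_nonneg (fun l _ => hnn k l)).1 h5 l (Finset.mem_univ _)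
    have h7 := (mul_eq_zero.1 h6).resolve_left (E.c_pos k l hkl).ne'
    have := pow_eq_zero_iff (two_ne_zero) |>.1 h7
    linarith
  obtain ⟨p⟩ := E.connected.preconnected k b
  induction p with
  | nil => exact hb
  | cons hab q ih => rw [h4 _ _ hab]; exact ih hb

end Network

/-- **Combinatorial formula for the voltages in a two-terminal electrical circuit**
(Proposition 2.7(1)).  Let the boundary vertices be `v₀` ("1") and `v₁` ("2") with
prescribed voltages `1` and `0`.  Then `w(1|2) > 0` and for every vertex `k ≠ v₁`,
`U k · w(1|2) = w(1k|2)`, where `w(1|2)` is the sum of the weights of all spanning bitrees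
separating `v₀` from `v₁`, and `w(1k|2)` is the sum over those with `k` in the component
of `v₀`. -/
theorem voltage_two_terminal (E : Network) (h2 : E.m = 2)
    (U : Fin E.n → ℝ) (I : Fin E.n → Fin E.n → ℝ)
    (hOhm : ∀ k l, I k l = E.c k l * (U k - U l))
    (hKir : ∀ k : Fin E.n, E.m ≤ (k : ℕ) → ∑ l, I k l = 0) :
    ∀ v₀ v₁ : Fin E.n, (v₀ : ℕ) = 0 → (v₁ : ℕ) = 1 → U v₀ = 1 → U v₁ = 0 →
      (0 < ∑ H ∈ Finset.univ.filter (fun H => E.IsSpanningForest H ∧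
            Nat.card H.ConnectedComponent = 2 ∧ ¬ H.Reachable v₀ v₁), E.weight H) ∧
      ∀ k : Fin E.n, k ≠ v₁ →
        U k * (∑ H ∈ Finset.univ.filter (fun H => E.IsSpanningForest H ∧
            Nat.card H.ConnectedComponent = 2 ∧ ¬ H.Reachable v₀ v₁), E.weight H)
        = ∑ H ∈ Finset.univ.filter (fun H => E.IsSpanningForest H ∧
            Nat.card H.ConnectedComponent = 2 ∧ ¬ H.Reachable v₀ v₁ ∧ H.Reachable v₀ k),
            E.weight H := by
  intro v₀ v₁ h0 h1 hU0 hU1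
  have hne : v₀ ≠ v₁ := by
    intro h; rw [h, h1] at h0; exact one_ne_zero h0
  have hW := E.bitrees_sum_pos v₀ v₁ hne
  refine ⟨hW, fun k _ => ?_⟩
  have hV0 : E.vv v₀ v₁ v₀ = ∑ H ∈ E.bitrees v₀ v₁, E.weight H := by
    simp [Network.vv, Network.ind]
  have hV1 : E.vv v₀ v₁ v₁ = 0 := by
    apply Finset.sum_eq_zero
    intro H hH
    have : ¬ H.Reachable v₁ v₀ := fun h => (Finset.mem_filter.1 hH).2.2.2 h.symm
    simp [Network.ind, this]
  have hVk : E.vv v₀ v₁ k = ∑ H ∈ Finset.univ.filter (fun H => E.IsSpanningForest H ∧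
            Nat.card H.ConnectedComponent = 2 ∧ ¬ H.Reachable v₀ v₁ ∧ H.Reachable v₀ k),
            E.weight H := by
    simp only [Network.vv, Network.ind, Network.bitrees, mul_ite, mul_one, mul_zero]
    rw [← Finset.sum_filter, Finset.filter_filter]
    refine Finset.sum_congr (Finset.filter_congr fun H _ => ?_) (fun _ _ => rfl)
    rw [SimpleGraph.reachable_comm (u := k)]
    tauto
  rw [← hVk]
  change U k * (∑ H ∈ E.bitrees v₀ v₁, E.weight H) = _
  generalize (∑ H ∈ E.bitrees v₀ v₁, E.weight H) = W at *
  have := E.eq_zero_of_harmonic (fun k => U k * W - E.vv v₀ v₁ k) v₁ (by simp [hU1, hV1]) ?_ k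
  · linarith
  intro j
  by_cases hj0 : j = v₀
  · left; rw [hj0]; simp [hU0, hV0]
  by_cases hj1 : j = v₁
  · left; rw [hj1]; simp [hU1, hV1]
  right
  have e1 := E.vv_harmonic v₀ v₁ j hj0 hj1
  have e2 := hKir j (by
    have a0 : (j : ℕ) ≠ 0 := fun h => hj0 (Fin.ext (h.trans h0.symm))
    have a1 : (j : ℕ) ≠ 1 := fun h => hj1 (Fin.ext (h.trans h1.symm))
    omega)
  simp_rw [hOhm] at e2
  have : ∑ l, E.c j l * (U j * W - E.vv v₀ v₁ j - (U l * W - E.vv v₀ v₁ l)) =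
      (∑ l, E.c j l * (U j - U l)) * W - ∑ l, E.c j l * (E.vv v₀ v₁ j - E.vv v₀ v₁ l) := by
    rw [Finset.sum_mul, ← Finset.sum_sub_distrib]
    refine Finset.sum_congr rfl fun l _ => ?_
    ring
  rw [this, e1, e2]; simp

end ElecNet
end
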